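/- arXiv:2507.11828 — 2 statements merged into one kernel-verified Lean document; each statement's English description precedes it below -/
import Mathlib

section
/- Let q be an odd prime and k ≥ 1 a natural number. Let S = {s_1, …, s_ℓ} be a set of exactly ℓ = q^k + q^{k−1} + … + q + 1 distinct nonzero integers, none of which is a perfect q-th power; let n be the number of distinct primes dividing ∏_{j=1}^{ℓ} rad_q(|s_j|) and let 𝒮 ⊆ PG(F_q^n) be the set of projective points associated with S. Then S belongs to 𝒯_{k,q} if and only if 𝒮 is a k-space of PG(F_q^n), i.e., 𝒮 = {⟨w⟩ : w ∈ W, w ≠ 0} for some (k+1)-dimensional F_q-linear subspace W of F_q^n. -/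
open Finset

/-- `S ∈ 𝒯_{k,q}`: there is a positive integer `Δ` such that for every natural number `N`
with `Ω(N) ≤ k` and `gcd(N, Δ) = 1`, some `s ∈ S` is a `q`-th power modulo `N`. -/
def MemT (q k : ℕ) (S : Set ℤ) : Prop :=
  ∃ Δ : ℕ, 0 < Δ ∧ ∀ N : ℕ, 0 < N → N.primeFactorsList.length ≤ k → Nat.Coprime N Δ →
    ∃ s ∈ S, ∃ x : ℤ, (N : ℤ) ∣ x ^ q - s

/-- `s` is a perfect `q`-th power of an integer. -/
def IsPerfectPow (q : ℕ) (s : ℤ) : Prop := ∃ r : ℤ, r ^ q = s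

/-- The finite set of primes dividing `∏_{s ∈ S} rad_q(|s|)`, i.e. the primes `p` such that
`q ∤ v_p(|s|)` for some `s ∈ S`. -/
def qPrimes (q : ℕ) (S : Finset ℤ) : Finset ℕ :=
  S.sup fun s => s.natAbs.primeFactors.filter fun p => ¬ q ∣ s.natAbs.factorization p

/-- The vector `(v_{p_1}(|u|) mod q, …, v_{p_n}(|u|) mod q)` where `p_1 < … < p_n`
is the increasing enumeration of the finite set of primes `P`. -/
def vecOf (q : ℕ) (P : Finset ℕ) (u : ℤ) : Fin P.card → ZMod q :=
  fun i => ((u.natAbs.factorization (P.orderIsoOfFin rfl i).1 : ℕ) : ZMod q)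

/-- The projective point `⟨v⟩` of `PG(F_q^n)` spanned by a vector `v`. -/
def projPoint {q n : ℕ} (v : Fin n → ZMod q) : Submodule (ZMod q) (Fin n → ZMod q) :=
  Submodule.span (ZMod q) {v}

/-- The set of projective points associated with `S` in `PG(F_q^n)`,
`n` being the number of distinct primes dividing `∏_{s ∈ S} rad_q(|s|)`. -/
def assocPoints (q : ℕ) (S : Finset ℤ) :
    Set (Submodule (ZMod q) (Fin (qPrimes q S).card → ZMod q)) :=
  {P | ∃ s ∈ S, P = projPoint (vecOf q (qPrimes q S) s)}

/-- `B` is a `k`-blocking set of `PG(F_q^n)`: every subspace of codimension `k`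
contains a nonzero vector spanning a point of `B`. -/
def IsBlockingSet (q n k : ℕ) (B : Set (Submodule (ZMod q) (Fin n → ZMod q))) : Prop :=
  ∀ W : Submodule (ZMod q) (Fin n → ZMod q), Module.finrank (ZMod q) W = n - k →
    ∃ v ∈ W, v ≠ 0 ∧ projPoint v ∈ B

/-- `B` is (the point set of) a `k`-space of `PG(F_q^n)`. -/
def IsKSpace (q n k : ℕ) (B : Set (Submodule (ZMod q) (Fin n → ZMod q))) : Prop :=
  ∃ W : Submodule (ZMod q) (Fin n → ZMod q), Module.finrank (ZMod q) W = k + 1 ∧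
    B = {P | ∃ v ∈ W, v ≠ 0 ∧ P = projPoint v}

/-- `S` and `T` are geometrically `q`-equivalent: some element of `PGL(n, q)` maps the point set
associated with `S` onto the point set associated with `T`, where the points are computed with
respect to all the primes dividing `(∏_{s ∈ S} rad_q(|s|)) ⬝ (∏_{t ∈ T} rad_q(|t|))`. -/
def GeomEquiv (q : ℕ) (S T : Finset ℤ) : Prop :=
  ∃ Ψ : (Fin (qPrimes q (S ∪ T)).card → ZMod q) ≃ₗ[ZMod q]
        (Fin (qPrimes q (S ∪ T)).card → ZMod q),
    (Submodule.map Ψ.toLinearMap) ''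
        {P | ∃ s ∈ S, P = projPoint (vecOf q (qPrimes q (S ∪ T)) s)} =
      {P | ∃ t ∈ T, P = projPoint (vecOf q (qPrimes q (S ∪ T)) t)}

/-- The set of squares of `F_qˣ` together with `0`. -/
def Q0 (q : ℕ) : Set (ZMod q) := {x | (∃ a : ZMod q, a ≠ 0 ∧ a ^ 2 = x) ∨ x = 0}

open NumberField in
/-- real Dedekind zeta -/
noncomputable def rZ (K : Type*) [Field K] [NumberField K] (s : ℝ) : ℝ :=
  ∑' n : ℕ, (Nat.card {I : Ideal (𝓞 K) // Ideal.absNorm I = n} : ℝ) * (n : ℝ) ^ (-s)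

open NumberField Filter Topology in
theorem rZ_term (K : Type*) [Field K] [NumberField K] (s : ℝ) (hs : 0 < s) (n : ℕ) :
    LSeries.term (fun n ↦ (Nat.card {I : Ideal (𝓞 K) // Ideal.absNorm I = n} : ℂ)) s n =
    (((Nat.card {I : Ideal (𝓞 K) // Ideal.absNorm I = n} : ℝ) * (n : ℝ) ^ (-s) : ℝ) : ℂ) := by
  rcases eq_or_ne n 0 with rfl | hn
  · simp [Real.zero_rpow (neg_ne_zero.mpr hs.ne')]
  · rw [LSeries.term_of_ne_zero hn]
    rw [Real.rpow_neg (Nat.cast_nonneg _)]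
    push_cast
    rw [Complex.ofReal_cpow (Nat.cast_nonneg _)]
    simp [div_eq_mul_inv]

open NumberField Filter Topology in
theorem rZ_eq (K : Type*) [Field K] [NumberField K] (s : ℝ) (hs : 0 < s) :
    dedekindZeta K s = (rZ K s : ℂ) := by
  unfold dedekindZeta LSeries rZ
  rw [Complex.ofReal_tsum]
  exact tsum_congr (rZ_term K s hs)

open NumberField Filter Topology in
theorem rZ_tendsto (K : Type*) [Field K] [NumberField K] :
    ∃ κ : ℝ, 0 < κ ∧ Tendsto (fun s : ℝ => (s - 1) * rZ K s) (𝓝[>] 1) (𝓝 κ) := by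
  refine ⟨dedekindZeta_residue K, dedekindZeta_residue_pos K, ?_⟩
  have h := tendsto_sub_one_mul_dedekindZeta_nhdsGT K
  have h2 := (Complex.continuous_re.tendsto _).comp h
  simp only [Complex.ofReal_re] at h2
  refine h2.congr' ?_
  filter_upwards [self_mem_nhdsWithin] with s hs
  have hs' : (0:ℝ) < s := lt_trans one_pos hs
  simp only [Function.comp]
  rw [rZ_eq K s hs', ← Complex.ofReal_one, ← Complex.ofReal_sub, ← Complex.ofReal_mul,
    Complex.ofReal_re]

open NumberField Filter Topology in
theorem rZ_summable (K : Type*) [Field K] [NumberField K] :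
    ∀ᶠ s : ℝ in 𝓝[>] 1, Summable (fun n : ℕ =>
      (Nat.card {I : Ideal (𝓞 K) // Ideal.absNorm I = n} : ℝ) * (n : ℝ) ^ (-s)) := by
  obtain ⟨κ, hκ, h⟩ := rZ_tendsto K
  filter_upwards [h.eventually (lt_mem_nhds hκ)] with s hs
  by_contra hn
  unfold rZ at hs
  rw [tsum_eq_zero_of_not_summable hn] at hs
  simp at hs

open NumberField in
/-- finite sums over ideals are bounded by zeta -/
theorem sum_le_rZ (K : Type*) [Field K] [NumberField K] (s : ℝ)
    (hsum : Summable (fun n : ℕ =>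
      (Nat.card {I : Ideal (𝓞 K) // Ideal.absNorm I = n} : ℝ) * (n : ℝ) ^ (-s)))
    (T : Finset (Ideal (𝓞 K))) :
    ∑ I ∈ T, (Ideal.absNorm I : ℝ) ^ (-s) ≤ rZ K s := by
  classical
  calc ∑ I ∈ T, (Ideal.absNorm I : ℝ) ^ (-s)
      = ∑ n ∈ T.image Ideal.absNorm, ∑ I ∈ T with Ideal.absNorm I = n,
          (Ideal.absNorm I : ℝ) ^ (-s) := by
        rw [Finset.sum_fiberwise_of_maps_to]
        intro I hI; exact Finset.mem_image_of_mem _ hI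
    _ ≤ ∑ n ∈ T.image Ideal.absNorm, 
        (Nat.card {I : Ideal (𝓞 K) // Ideal.absNorm I = n} : ℝ) * (n : ℝ) ^ (-s) := by
        refine Finset.sum_le_sum fun n _ => ?_
        rw [Finset.sum_congr rfl (g := fun _ => (n : ℝ) ^ (-s)) (by
          intro I hI; rw [(Finset.mem_filter.mp hI).2])]
        rw [Finset.sum_const, nsmul_eq_mul]
        gcongr
        have hfin := Ideal.finite_setOfPred_absNorm_eq (S := 𝓞 K) n
        have : Nat.card {I : Ideal (𝓞 K) // Ideal.absNorm I = n} = hfin.toFinset.card :=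
          Nat.card_eq_card_finite_toFinset hfin
        rw [this]
        apply Finset.card_le_card
        intro I hI
        simpa using (Finset.mem_filter.mp hI).2
    _ ≤ rZ K s := hsum.sum_le_tsum _ (fun n _ => by positivity)

open NumberField in
theorem rZ_le (K : Type*) [Field K] [NumberField K] (s C : ℝ) (hs : 0 < s)
    (hC : ∀ T : Finset (Ideal (𝓞 K)), (∀ I ∈ T, I ≠ ⊥) →
      ∑ I ∈ T, (Ideal.absNorm I : ℝ) ^ (-s) ≤ C) : rZ K s ≤ C := by
  classical
  have key : ∀ u : Finset ℕ, ∑ n ∈ u,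
      (Nat.card {I : Ideal (𝓞 K) // Ideal.absNorm I = n} : ℝ) * (n : ℝ) ^ (-s) ≤ C := by
    intro u
    have hfin : {I : Ideal (𝓞 K) | Ideal.absNorm I ∈ u}.Finite := by
      have : {I : Ideal (𝓞 K) | Ideal.absNorm I ∈ u} =
        ⋃ n ∈ u, {I | Ideal.absNorm I = n} := by ext; simp
      rw [this]
      exact u.finite_toSet.biUnion fun n _ => Ideal.finite_setOfPred_absNorm_eq (S := 𝓞 K) n
    let T := hfin.toFinset
    have h1 : ∑ I ∈ T, (Ideal.absNorm I : ℝ) ^ (-s) = ∑ n ∈ u,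
      (Nat.card {I : Ideal (𝓞 K) // Ideal.absNorm I = n} : ℝ) * (n : ℝ) ^ (-s) := by
      rw [← Finset.sum_fiberwise_of_maps_to (s := T) (t := u) (g := Ideal.absNorm)]
      · refine Finset.sum_congr rfl fun n hn => ?_
        rw [Finset.sum_congr rfl (g := fun _ => (n : ℝ) ^ (-s)) (by
          intro I hI; rw [(Finset.mem_filter.mp hI).2])]
        rw [Finset.sum_const, nsmul_eq_mul]
        congr 2
        have hfin' := Ideal.finite_setOfPred_absNorm_eq (S := 𝓞 K) n
        have : Nat.card {I : Ideal (𝓞 K) // Ideal.absNorm I = n} = hfin'.toFinset.card :=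
          Nat.card_eq_card_finite_toFinset hfin'
        rw [this]
        congr 1
        ext I
        simp only [T, Finset.mem_filter, Set.Finite.mem_toFinset, Set.mem_ofPred_eq]
        constructor
        · exact fun h => h.2
        · intro h; exact ⟨h ▸ hn, h⟩
      · intro I hI
        simpa [T] using hI
    rw [← h1]
    have h2 : ∑ I ∈ T, (Ideal.absNorm I : ℝ) ^ (-s) =
        ∑ I ∈ T.filter (· ≠ ⊥), (Ideal.absNorm I : ℝ) ^ (-s) := by
      symm
      apply Finset.sum_filter_of_ne
      intro I _ h hb
      apply h
      rw [hb]
      simp [Real.zero_rpow (neg_ne_zero.mpr hs.ne')]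
    rw [h2]
    exact hC _ (fun I hI => (Finset.mem_filter.mp hI).2)
  refine Real.tsum_le_of_sum_le (fun n => by positivity) key

theorem inv_one_sub_le_exp (x : ℝ) (h0 : 0 ≤ x) (h1 : x ≤ 1/2) :
    (1 - x)⁻¹ ≤ Real.exp (x + 2 * x ^ 2) := by
  have h : (1 - x)⁻¹ ≤ (x + 2 * x^2) + 1 := by
    rw [inv_le_iff_one_le_mul₀ (by linarith)]
    nlinarith [sq_nonneg x, mul_nonneg (sq_nonneg x) (by linarith : 0 ≤ 1 - 2 * x)]
  exact h.trans (Real.add_one_le_exp _)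

theorem exp_le_one_add (x : ℝ) (h0 : 0 ≤ x) :
    Real.exp (x - x ^ 2) ≤ 1 + x := by
  have h := Real.add_one_le_exp (-(x - x^2))
  rw [Real.exp_neg] at h
  have hp := Real.exp_pos (x - x^2)
  have h2 : (-(x - x^2) + 1) * Real.exp (x - x^2) ≤ 1 := by
    calc _ ≤ (Real.exp (x - x^2))⁻¹ * Real.exp (x - x^2) := by gcongr
      _ = 1 := inv_mul_cancel₀ hp.ne'
  have h3 : 0 < -(x - x^2) + 1 := by nlinarith [sq_nonneg (x - 1)]
  by_contra hc
  push Not at hc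
  have : (-(x - x^2) + 1) * (1 + x) < 1 := lt_of_lt_of_le (mul_lt_mul_of_pos_left hc h3) h2
  nlinarith [pow_nonneg h0 3]

section
variable {R : Type*} [CommRing R] [IsDedekindDomain R]

theorem eq_of_prime_dvd_prime {P Q : Ideal R} (hP : P.IsPrime) (hP0 : P ≠ ⊥) (hQ : Q.IsPrime)
    (hQ0 : Q ≠ ⊥) (h : P ∣ Q) : P = Q := by
  have := hQ.isMaximal hQ0
  exact (this.eq_of_le hP.ne_top (Ideal.dvd_iff_le.mp h)).symm

theorem prod_primes_injOn (PP : Finset (Ideal R)) (hPP : ∀ P ∈ PP, P.IsPrime ∧ P ≠ ⊥) :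
    Set.InjOn (fun U : Finset (Ideal R) => ∏ P ∈ U, P) (PP.powerset : Set (Finset (Ideal R))) := by
  have key : ∀ U ∈ PP.powerset, ∀ P ∈ PP, P ∈ U ↔ P ∣ ∏ Q ∈ U, Q := by
    intro U hU P hP
    rw [Finset.mem_powerset] at hU
    constructor
    · exact fun h => Finset.dvd_prod_of_mem _ h
    · intro h
      have hp : Prime P := Ideal.prime_of_isPrime (hPP P hP).2 (hPP P hP).1
      obtain ⟨Q, hQ, hd⟩ := (hp.dvd_finsetProd_iff _).mp h
      rwa [eq_of_prime_dvd_prime (hPP P hP).1 (hPP P hP).2 (hPP Q (hU hQ)).1 (hPP Q (hU hQ)).2 hd]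
  intro U hU V hV h
  simp only [Finset.mem_coe] at hU hV
  simp only at h
  ext P
  constructor
  · intro hP
    have hP' := Finset.mem_powerset.mp hU hP
    rw [key V hV P hP', ← h]
    exact (key U hU P hP').mp hP
  · intro hP
    have hP' := Finset.mem_powerset.mp hV hP
    rw [key U hU P hP', h]
    exact (key V hV P hP').mp hP
end

section
open UniqueFactorizationMonoid

variable {R : Type*} [CommRing R] [IsDedekindDomain R] [Module.Free ℤ R] 

open Classical in
theorem ideal_eq_prod {I : Ideal R} (hI : I ≠ ⊥) (PP : Finset (Ideal R))
    (h : (normalizedFactors I).toFinset ⊆ PP) :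
    I = ∏ P ∈ PP, P ^ (normalizedFactors I).count P := by
  conv_lhs => rw [← Ideal.prod_normalizedFactors_eq_self hI]
  rw [Finset.prod_multiset_count]
  apply Finset.prod_subset h
  intro P _ hP
  rw [Multiset.count_eq_zero_of_notMem, pow_zero]
  exact fun h => hP (Multiset.mem_toFinset.mpr h)

open Classical in
theorem sum_norm_le_prod [Module.Finite ℤ R] [CharZero R] (s : ℝ) (hs : 1 < s)
    (T : Finset (Ideal R)) (hT : ∀ I ∈ T, I ≠ ⊥) :
    ∃ PP : Finset (Ideal R), (∀ P ∈ PP, P.IsPrime ∧ P ≠ ⊥) ∧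
    ∑ I ∈ T, (Ideal.absNorm I : ℝ) ^ (-s) ≤
      ∏ P ∈ PP, (1 - (Ideal.absNorm P : ℝ) ^ (-s))⁻¹ := by
  let PP : Finset (Ideal R) := T.biUnion fun I => (normalizedFactors I).toFinset
  have hsub : ∀ I ∈ T, (normalizedFactors I).toFinset ⊆ PP :=
    fun I hI => Finset.subset_biUnion_of_mem (fun I => (normalizedFactors I).toFinset) hI
  have hPP : ∀ P ∈ PP, P.IsPrime ∧ P ≠ ⊥ := by
    intro P hP
    simp only [PP, Finset.mem_biUnion, Multiset.mem_toFinset] at hP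
    obtain ⟨I, _, hPI⟩ := hP
    have := prime_of_normalized_factor P hPI
    exact ⟨Ideal.isPrime_of_prime this, this.ne_zero⟩
  refine ⟨PP, hPP, ?_⟩
  let x : Ideal R → ℝ := fun P => (Ideal.absNorm P : ℝ) ^ (-s)
  have hx0 : ∀ P, 0 ≤ x P := fun P => by positivity
  have hx1 : ∀ P ∈ PP, x P < 1 := by
    intro P hP
    have h0 : Ideal.absNorm P ≠ 0 := by
      rw [Ne, Ideal.absNorm_eq_zero_iff]; exact (hPP P hP).2
    have h1 : Ideal.absNorm P ≠ 1 := by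
      rw [Ne, Ideal.absNorm_eq_one_iff]; exact (hPP P hP).1.ne_top
    have h2 : 1 < Ideal.absNorm P := by omega
    exact Real.rpow_lt_one_of_one_lt_of_neg (by exact_mod_cast h2) (by linarith)
  let J : ℕ := (∑ I ∈ T, ∑ P ∈ PP, (normalizedFactors I).count P) + 1
  have hJ : ∀ I ∈ T, ∀ P ∈ PP, (normalizedFactors I).count P < J := by
    intro I hI P hP
    apply Nat.lt_succ_of_le
    calc _ ≤ ∑ P ∈ PP, (normalizedFactors I).count P :=
          Finset.single_le_sum (f := fun P => (normalizedFactors I).count P)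
            (fun _ _ => Nat.zero_le _) hP
      _ ≤ _ := Finset.single_le_sum
            (f := fun I => ∑ P ∈ PP, (normalizedFactors I).count P)
            (fun _ _ => Nat.zero_le _) hI
  calc ∑ I ∈ T, (Ideal.absNorm I : ℝ) ^ (-s)
      = ∑ I ∈ T, ∏ P ∈ PP.attach, x P.1 ^ ((fun (P : Ideal R) (_ : P ∈ PP) =>
          (normalizedFactors I).count P) P.1 P.2) := by
        refine Finset.sum_congr rfl fun I hI => ?_
        rw [Finset.prod_attach PP (fun P => x P ^ (normalizedFactors I).count P)]
        conv_lhs => rw [ideal_eq_prod (hT I hI) PP (hsub I hI)]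
        rw [map_prod, Nat.cast_prod, ← Real.finsetProd_rpow _ _ (fun _ _ => by positivity)]
        refine Finset.prod_congr rfl fun P _ => ?_
        simp only [x, map_pow, Nat.cast_pow]
        rw [← Real.rpow_natCast, ← Real.rpow_natCast, ← Real.rpow_mul (by positivity),
          ← Real.rpow_mul (by positivity), mul_comm]
    _ = ∑ p ∈ T.image (fun I => (fun (P : Ideal R) (_ : P ∈ PP) =>
          (normalizedFactors I).count P)), ∏ P ∈ PP.attach, x P.1 ^ (p P.1 P.2) := by
        rw [Finset.sum_image]
        intro I hI I' hI' h
        rw [ideal_eq_prod (hT I hI) PP (hsub I hI), ideal_eq_prod (hT I' hI') PP (hsub I' hI')]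
        refine Finset.prod_congr rfl fun P hP => ?_
        have := congrFun (congrFun h P) hP
        simp only at this
        rw [this]
    _ ≤ ∑ p ∈ PP.pi (fun _ => Finset.range J), ∏ P ∈ PP.attach, x P.1 ^ (p P.1 P.2) := by
        apply Finset.sum_le_sum_of_subset_of_nonneg
        · intro p hp
          obtain ⟨I, hI, rfl⟩ := Finset.mem_image.mp hp
          rw [Finset.mem_pi]
          intro P hP
          exact Finset.mem_range.mpr (hJ I hI P hP)
        · intro p _ _
          exact Finset.prod_nonneg fun P _ => pow_nonneg (hx0 _) _
    _ = ∏ P ∈ PP, ∑ j ∈ Finset.range J, x P ^ j := by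
        rw [Finset.prod_sum]
    _ ≤ ∏ P ∈ PP, (1 - x P)⁻¹ := by
        apply Finset.prod_le_prod
        · intro P _; exact Finset.sum_nonneg fun j _ => pow_nonneg (hx0 _) _
        · intro P hP
          rw [← tsum_geometric_of_lt_one (hx0 P) (hx1 P hP)]
          exact (summable_geometric_of_lt_one (hx0 P) (hx1 P hP)).sum_le_tsum _
            (fun j _ => pow_nonneg (hx0 _) _)

open Classical in
/-- the number of primes above `p` -/
theorem card_primes_le [Module.Finite ℤ R] [CharZero R] (p : ℕ) (hp : p.Prime)
    (PP : Finset (Ideal R)) (hPP : ∀ P ∈ PP, P.IsPrime ∧ (p : R) ∈ P) :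
    ∏ P ∈ PP, Ideal.absNorm P ≤ p ^ Module.finrank ℤ R ∧
    (∀ P ∈ PP, p ≤ Ideal.absNorm P) ∧ 
    PP.card ≤ Module.finrank ℤ R := by
  have hbot : Ideal.span {(p : R)} ≠ ⊥ := by
    rw [Ne, Ideal.span_singleton_eq_bot]; exact_mod_cast hp.ne_zero
  have hle : ∀ P ∈ PP, Ideal.span {(p : R)} ≤ P := fun P hP => by
    rw [Ideal.span_singleton_le_iff_mem]; exact (hPP P hP).2
  have hne : ∀ P ∈ PP, P ≠ ⊥ := fun P hP h => hbot (by
    have := hle P hP; rw [h] at this; exact le_bot_iff.mp this)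
  have hN : Ideal.absNorm (Ideal.span {(p : R)}) = p ^ Module.finrank ℤ R :=
    Ideal.absNorm_span_natCast p
  have h1 : ∏ P ∈ PP, P ∣ Ideal.span {(p : R)} := by
    apply Finset.prod_primes_dvd
    · intro P hP; exact Ideal.prime_of_isPrime (hne P hP) (hPP P hP).1
    · intro P hP; exact Ideal.dvd_iff_le.mpr (hle P hP)
  have h2 : ∏ P ∈ PP, Ideal.absNorm P ≤ p ^ Module.finrank ℤ R := by
    rw [← hN, ← map_prod]
    apply Nat.le_of_dvd
    · rw [hN]; exact pow_pos hp.pos _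
    · exact map_dvd _ h1
  have h3 : ∀ P ∈ PP, p ≤ Ideal.absNorm P := by
    intro P hP
    have hd : Ideal.absNorm P ∣ p ^ Module.finrank ℤ R := by
      rw [← hN]; exact Ideal.absNorm_dvd_absNorm_of_le (hle P hP)
    obtain ⟨f, _, hf⟩ := (Nat.dvd_prime_pow hp).mp hd
    rw [hf]
    apply Nat.le_self_pow
    rintro rfl
    apply (hPP P hP).1.ne_top
    rw [← Ideal.absNorm_eq_one_iff, hf, pow_zero]
  refine ⟨h2, h3, ?_⟩
  have h4 : p ^ PP.card ≤ p ^ Module.finrank ℤ R := by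
    refine le_trans ?_ h2
    rw [← Finset.prod_const]
    exact Finset.prod_le_prod' h3
  exact (Nat.pow_le_pow_iff_right hp.one_lt).mp h4

theorem norm_prime_pow [Module.Finite ℤ R] [CharZero R] (P : Ideal R)
    (hP : P.IsPrime) (hP0 : P ≠ ⊥) :
    ∃ p f : ℕ, p.Prime ∧ 0 < f ∧ Ideal.absNorm P = p ^ f ∧ (p : R) ∈ P := by
  have := hP.isMaximal hP0
  have h0 : Ideal.absNorm P ≠ 0 := by
    rw [Ne, Ideal.absNorm_eq_zero_iff]; exact hP0
  obtain ⟨p, hp, hm⟩ : ∃ p : ℕ, p.Prime ∧ (p : R) ∈ P := by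
    have hm := Ideal.absNorm_mem P
    rw [← Nat.prod_primeFactorsList h0] at hm
    rw [Nat.cast_list_prod, ← Multiset.prod_coe] at hm
    obtain ⟨x, hx, hxP⟩ := (Ideal.IsPrime.multiset_prod_mem_iff_exists_mem hP _).mp hm
    simp only [Multiset.mem_coe, List.mem_map] at hx
    obtain ⟨p, hp, rfl⟩ := hx
    exact ⟨p, Nat.prime_of_mem_primeFactorsList hp, hxP⟩
  have hle : Ideal.span {(p : R)} ≤ P := by
    rw [Ideal.span_singleton_le_iff_mem]; exact hm
  have hd := Ideal.absNorm_dvd_absNorm_of_le hle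
  rw [Ideal.absNorm_span_natCast] at hd
  obtain ⟨f, _, hf⟩ := (Nat.dvd_prime_pow hp).mp hd
  refine ⟨p, f, hp, ?_, hf, hm⟩
  rw [Nat.pos_iff_ne_zero]
  rintro rfl
  apply hP.ne_top
  rw [← Ideal.absNorm_eq_one_iff, hf, pow_zero]

end

open Classical in
open NumberField in
theorem prod_le_rZ (E : Type*) [Field E] [NumberField E] (s : ℝ)
    (hsum : Summable (fun n : ℕ =>
      (Nat.card {I : Ideal (𝓞 E) // Ideal.absNorm I = n} : ℝ) * (n : ℝ) ^ (-s)))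
    (PP : Finset (Ideal (𝓞 E))) (hPP : ∀ P ∈ PP, P.IsPrime ∧ P ≠ ⊥) :
    ∏ P ∈ PP, (1 + (Ideal.absNorm P : ℝ) ^ (-s)) ≤ rZ E s := by
  rw [Finset.prod_one_add]
  have h := sum_le_rZ E s hsum (PP.powerset.image fun U => ∏ P ∈ U, P)
  rw [Finset.sum_image (prod_primes_injOn PP hPP)] at h
  refine le_trans (le_of_eq ?_) h
  refine Finset.sum_congr rfl fun U _ => ?_
  rw [map_prod, Nat.cast_prod, ← Real.finsetProd_rpow _ _ (fun _ _ => by positivity)]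

open Classical in
open NumberField in
theorem lower_bound (E : Type*) [Field E] [NumberField E] (A : Set ℕ) (hA : ∀ p ∈ A, p.Prime)
    (D : ℕ)
    (hE : ∀ p ∈ A, ∃ T : Finset (Ideal (𝓞 E)), T.card = D ∧
      ∀ P ∈ T, P.IsPrime ∧ Ideal.absNorm P = p) (s : ℝ) (hs : 1 < s)
    (hsum : Summable (fun n : ℕ =>
      (Nat.card {I : Ideal (𝓞 E) // Ideal.absNorm I = n} : ℝ) * (n : ℝ) ^ (-s)))
    (B : Finset ℕ) (hB : ∀ p ∈ B, p ∈ A) :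
    Real.exp (D * ∑ p ∈ B, (p : ℝ) ^ (-s) - D * ∑' n : ℕ, (n : ℝ) ^ (-2 : ℝ)) ≤ rZ E s := by
  choose! T hTc hT using hE
  have hdisj : (B : Set ℕ).PairwiseDisjoint T := by
    intro p hp r hr hpr
    rw [Function.onFun, Finset.disjoint_left]
    intro P h1 h2
    exact hpr ((hT p (hB p hp) P h1).2.symm.trans (hT r (hB r hr) P h2).2)
  refine le_trans ?_ (prod_le_rZ E s hsum (B.biUnion T) ?_)
  · rw [Finset.prod_biUnion hdisj]
    calc _ ≤ Real.exp (∑ p ∈ B, D * ((p : ℝ) ^ (-s) - ((p : ℝ) ^ (-s)) ^ 2)) := by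
          apply Real.exp_le_exp.mpr
          rw [← Finset.mul_sum, ← mul_sub, Finset.sum_sub_distrib]
          gcongr
          have hsm : Summable (fun n : ℕ => (n : ℝ) ^ (-2 : ℝ)) :=
            Real.summable_nat_rpow.mpr (by norm_num)
          refine le_trans ?_ (hsm.sum_le_tsum B (fun _ _ => by positivity))
          refine Finset.sum_le_sum fun p hp => ?_
          have : 1 ≤ p := (hA p (hB p hp)).one_lt.le
          rw [← Real.rpow_natCast, ← Real.rpow_mul (by positivity)]
          apply Real.rpow_le_rpow_of_exponent_le (by exact_mod_cast this)
          push_cast; linarith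
      _ = ∏ p ∈ B, (Real.exp ((p : ℝ) ^ (-s) - ((p : ℝ) ^ (-s)) ^ 2)) ^ D := by
          rw [Real.exp_sum]
          refine Finset.prod_congr rfl fun p _ => ?_
          rw [← Real.exp_nat_mul]
      _ ≤ _ := by
          apply Finset.prod_le_prod (fun _ _ => by positivity)
          intro p hp
          rw [Finset.prod_congr rfl (g := fun _ => (1 + (p : ℝ) ^ (-s)))
            (by intro P hP; rw [(hT p (hB p hp) P hP).2])]
          rw [Finset.prod_const, hTc p (hB p hp)]
          gcongr
          exact exp_le_one_add _ (by positivity)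
  · intro P hP
    obtain ⟨p, hp, hPp⟩ := Finset.mem_biUnion.mp hP
    refine ⟨(hT p (hB p hp) P hPp).1, ?_⟩
    rw [Ne, ← Ideal.absNorm_eq_zero_iff, (hT p (hB p hp) P hPp).2]
    exact (hA p (hB p hp)).ne_zero

open Classical in
open NumberField in
theorem upper_bound (K : Type*) [Field K] [NumberField K] (A : Set ℕ)
    (M : ℕ) (hM : M ≠ 0)
    (hK : ∀ P : Ideal (𝓞 K), (Ideal.absNorm P).Prime → Ideal.absNorm P ∈ A ∨ Ideal.absNorm P ∣ M)
    (s : ℝ) (hs : 1 < s) (T : Finset (Ideal (𝓞 K))) (hT : ∀ I ∈ T, I ≠ ⊥) :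
    ∃ B : Finset ℕ, (∀ p ∈ B, p ∈ A) ∧ ∑ I ∈ T, (Ideal.absNorm I : ℝ) ^ (-s) ≤
      Real.exp (Module.finrank ℚ K * ∑ p ∈ B, (p : ℝ) ^ (-s) +
        Module.finrank ℚ K * (M.divisors.card + 3 * ∑' n : ℕ, (n : ℝ) ^ (-2 : ℝ))) := by
  obtain ⟨PP, hPP, hle⟩ := sum_norm_le_prod s hs T hT
  have hsm : Summable (fun n : ℕ => (n : ℝ) ^ (-2 : ℝ)) :=
            Real.summable_nat_rpow.mpr (by norm_num)
  have hr := fun P (hP : P ∈ PP) => norm_prime_pow P (hPP P hP).1 (hPP P hP).2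
  choose! r f hrp hf hrf hrm using hr
  let R := PP.image r
  let B := R.filter (· ∈ A)
  let g : ℕ → ℝ := fun p => (if p ∈ A then (p : ℝ) ^ (-s) else 0) +
    (if p ∣ M then 1 else 0) + 3 * (p : ℝ) ^ (-2 : ℝ)
  have hg0 : ∀ p, 0 ≤ g p := by
    intro p; simp only [g]; split_ifs <;> positivity
  refine ⟨B, fun p hp => (Finset.mem_filter.mp hp).2, hle.trans ?_⟩
  have hRp : ∀ p ∈ R, p.Prime := by
    intro p hp
    obtain ⟨P, hP, rfl⟩ := Finset.mem_image.mp hp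
    exact hrp P hP
  have step : ∀ P ∈ PP, (1 - (Ideal.absNorm P : ℝ) ^ (-s))⁻¹ ≤ Real.exp (g (r P)) := by
    intro P hP
    have hr2 : (2 : ℝ) ≤ r P := by exact_mod_cast (hrp P hP).two_le
    have hr1 : (1 : ℝ) ≤ r P := by linarith
    have hN : (r P : ℝ) ≤ Ideal.absNorm P := by
      rw [hrf P hP]; exact_mod_cast Nat.le_self_pow (hf P hP).ne' _
    have hN1 : (1 : ℝ) ≤ Ideal.absNorm P := by linarith
    have hx : (Ideal.absNorm P : ℝ) ^ (-s) ≤ 1 / 2 := by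
      calc (Ideal.absNorm P : ℝ) ^ (-s) ≤ (Ideal.absNorm P : ℝ) ^ (-1 : ℝ) :=
            Real.rpow_le_rpow_of_exponent_le hN1 (by linarith)
        _ = (Ideal.absNorm P : ℝ)⁻¹ := Real.rpow_neg_one _
        _ ≤ 1 / 2 := by
            rw [one_div]; apply inv_anti₀ (by norm_num) (by linarith)
    refine (inv_one_sub_le_exp _ (by positivity) hx).trans (Real.exp_le_exp.mpr ?_)
    have hsq : ((Ideal.absNorm P : ℝ) ^ (-s)) ^ 2 ≤ (r P : ℝ) ^ (-2 : ℝ) := by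
      calc ((Ideal.absNorm P : ℝ) ^ (-s)) ^ 2 ≤ ((r P : ℝ) ^ (-s)) ^ 2 := by
            gcongr ?_ ^ 2
            exact Real.rpow_le_rpow_of_nonpos (by linarith) hN (by linarith)
        _ = (r P : ℝ) ^ (-s * 2) := by
            rw [← Real.rpow_natCast, ← Real.rpow_mul (by positivity)]; norm_num
        _ ≤ _ := Real.rpow_le_rpow_of_exponent_le hr1 (by linarith)
    have hpos : (0 : ℝ) ≤ (r P : ℝ) ^ (-s) := by positivity
    have hr21 : (r P : ℝ) ^ (-s) ≤ 1 := Real.rpow_le_one_of_one_le_of_nonpos hr1 (by linarith)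
    rcases Nat.lt_or_ge 1 (f P) with h2 | h1
    · have : (Ideal.absNorm P : ℝ) ^ (-s) ≤ (r P : ℝ) ^ (-2 : ℝ) := by
        rw [hrf P hP]; push_cast
        rw [← Real.rpow_natCast, ← Real.rpow_mul (by positivity)]
        apply Real.rpow_le_rpow_of_exponent_le hr1
        have : (2 : ℝ) ≤ f P := by exact_mod_cast h2
        nlinarith
      simp only [g]
      split_ifs <;> linarith
    · have h1' : f P = 1 := le_antisymm h1 (hf P hP)
      have hNr : Ideal.absNorm P = r P := by rw [hrf P hP, h1', pow_one]
      have hpp : (0 : ℝ) ≤ (r P : ℝ) ^ (-2 : ℝ) := by positivity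
      have := hK P (by rw [hNr]; exact hrp P hP)
      rw [hNr] at this hsq ⊢
      simp only [g]
      rcases this with h | h
      · rw [if_pos h]; split_ifs <;> linarith
      · rw [if_pos h]; split_ifs <;> linarith
  calc _ ≤ ∏ P ∈ PP, Real.exp (g (r P)) := by
        refine Finset.prod_le_prod (fun P hP => ?_) step
        rw [inv_nonneg, sub_nonneg]
        have hN1 : (1 : ℝ) ≤ Ideal.absNorm P := by
          rw [hrf P hP]; exact_mod_cast Nat.one_le_pow _ _ (hrp P hP).pos
        exact Real.rpow_le_one_of_one_le_of_nonpos hN1 (by linarith)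
    _ = Real.exp (∑ P ∈ PP, g (r P)) := (Real.exp_sum _ _).symm
    _ ≤ _ := by
        apply Real.exp_le_exp.mpr
        rw [← mul_add]
        calc ∑ P ∈ PP, g (r P) = ∑ p ∈ R, ∑ P ∈ PP with r P = p, g (r P) := by
              rw [Finset.sum_fiberwise_of_maps_to]
              intro P hP; exact Finset.mem_image_of_mem _ hP
          _ ≤ ∑ p ∈ R, Module.finrank ℚ K * g p := by
              refine Finset.sum_le_sum fun p hp => ?_
              rw [Finset.sum_congr rfl (g := fun _ => g p) (by
                intro P hP; rw [(Finset.mem_filter.mp hP).2])]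
              rw [Finset.sum_const, nsmul_eq_mul]
              refine mul_le_mul_of_nonneg_right ?_ (hg0 p)
              have := (card_primes_le (R := 𝓞 K) p (hRp p hp) (PP.filter (r · = p)) (by
                intro P hP
                obtain ⟨hP1, hP2⟩ := Finset.mem_filter.mp hP
                exact ⟨(hPP P hP1).1, hP2 ▸ hrm P hP1⟩)).2.2
              rw [RingOfIntegers.rank] at this
              exact_mod_cast this
          _ = Module.finrank ℚ K * ∑ p ∈ R, g p := by rw [Finset.mul_sum]
          _ ≤ _ := by
              gcongr
              simp only [g]
              rw [Finset.sum_add_distrib, Finset.sum_add_distrib, add_assoc]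
              gcongr ?_ + (?_ + ?_)
              · rw [Finset.sum_filter]
              · rw [← Finset.sum_filter, Finset.sum_const, nsmul_eq_mul, mul_one]
                norm_cast
                apply Finset.card_le_card
                intro p hp
                exact Nat.mem_divisors.mpr ⟨(Finset.mem_filter.mp hp).2, hM⟩
              · rw [← Finset.mul_sum]
                gcongr
                exact hsm.sum_le_tsum _ (fun _ _ => by positivity)

open NumberField Filter Topology in
theorem zeta_compare (K E : Type*) [Field K] [NumberField K] [Field E] [NumberField E]
    (A : Set ℕ) (hA : ∀ p ∈ A, p.Prime) (M : ℕ) (hM : M ≠ 0)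
    (hK : ∀ P : Ideal (𝓞 K), (Ideal.absNorm P).Prime → Ideal.absNorm P ∈ A ∨ Ideal.absNorm P ∣ M)
    (D : ℕ) (hD : 2 * Module.finrank ℚ K ≤ D)
    (hE : ∀ p ∈ A, ∃ T : Finset (Ideal (𝓞 E)), T.card = D ∧
      ∀ P ∈ T, P.IsPrime ∧ Ideal.absNorm P = p) : False := by
  obtain ⟨κ, hκ, htK⟩ := rZ_tendsto K
  obtain ⟨κ', hκ', htE⟩ := rZ_tendsto E
  set C1 : ℝ := D * ∑' n : ℕ, (n : ℝ) ^ (-2 : ℝ)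
  set C2 : ℝ := Module.finrank ℚ K * (M.divisors.card + 3 * ∑' n : ℕ, (n : ℝ) ^ (-2 : ℝ))
  have hev : ∀ᶠ s : ℝ in 𝓝[>] 1, ((s - 1) * rZ K s) ^ 2 ≤
      Real.exp (2 * C2 + C1) * ((s - 1) * ((s - 1) * rZ E s)) := by
    filter_upwards [self_mem_nhdsWithin, rZ_summable E, htE.eventually (lt_mem_nhds hκ'),
      htK.eventually (lt_mem_nhds hκ)] with s hs hsum hpE hpK
    have hs1 : 1 < s := hs
    have hs0 : 0 < s - 1 := by linarith
    have hE0 : 0 < rZ E s := by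
      by_contra h; push Not at h; nlinarith
    have hK0 : 0 < rZ K s := by
      by_contra h; push Not at h; nlinarith
    have h1 : rZ K s ≤ Real.sqrt (Real.exp (2 * C2 + C1) * rZ E s) := by
      apply rZ_le K s _ (by linarith)
      intro T hT
      obtain ⟨B, hB, hTB⟩ := upper_bound K A M hM hK s hs1 T hT
      have hlow := lower_bound E A hA D hE s hs1 hsum B hB
      apply Real.le_sqrt_of_sq_le
      have hT0 : 0 ≤ ∑ I ∈ T, (Ideal.absNorm I : ℝ) ^ (-s) :=
        Finset.sum_nonneg fun _ _ => by positivity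
      have hB0 : 0 ≤ ∑ p ∈ B, (p : ℝ) ^ (-s) :=
        Finset.sum_nonneg fun _ _ => by positivity
      calc _ ≤ (Real.exp (Module.finrank ℚ K * ∑ p ∈ B, (p : ℝ) ^ (-s) + C2)) ^ 2 := by gcongr
        _ = Real.exp (2 * (Module.finrank ℚ K * ∑ p ∈ B, (p : ℝ) ^ (-s) + C2)) := by
            rw [← Real.exp_nat_mul]; norm_num
        _ ≤ Real.exp ((2 * C2 + C1) + (D * ∑ p ∈ B, (p : ℝ) ^ (-s) - C1)) := by
            apply Real.exp_le_exp.mpr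
            have : (2 * (Module.finrank ℚ K : ℝ)) ≤ D := by exact_mod_cast hD
            nlinarith
        _ = Real.exp (2 * C2 + C1) * Real.exp (D * ∑ p ∈ B, (p : ℝ) ^ (-s) - C1) :=
            Real.exp_add _ _
        _ ≤ _ := by gcongr
    have h2 : rZ K s ^ 2 ≤ Real.exp (2 * C2 + C1) * rZ E s := by
      have := (Real.le_sqrt hK0.le (by positivity)).mp h1
      exact this
    calc ((s - 1) * rZ K s) ^ 2 = (s-1)^2 * rZ K s ^ 2 := by ring
      _ ≤ (s-1)^2 * (Real.exp (2 * C2 + C1) * rZ E s) := by gcongr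
      _ = _ := by ring
  have hlim1 := htK.pow 2
  have hsub : Tendsto (fun s : ℝ => s - 1) (𝓝[>] 1) (𝓝 0) := by
    have : Tendsto (fun s : ℝ => s - 1) (𝓝 1) (𝓝 (1 - 1)) := by
      exact (continuous_id.sub continuous_const).tendsto 1
    rw [sub_self] at this
    exact this.mono_left nhdsWithin_le_nhds
  have hlim2 := (hsub.mul htE).const_mul (Real.exp (2 * C2 + C1))
  have := le_of_tendsto_of_tendsto hlim1 hlim2 hev
  simp at this
  nlinarith [pow_pos hκ 2]

theorem exists_nat_sub_mem {R : Type*} [CommRing R] (P : Ideal R) [hP : P.IsPrime] (p q m : ℕ)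
    (hp : p.Prime) (hpP : (p : R) ∈ P) (x : R) (hx : x ^ q = m) (c : ZMod p)
    (hc : c ^ q = m) (hm : ¬ p ∣ m) (hq1 : q ∣ p - 1) : ∃ a : ℕ, x - a ∈ P := by
  haveI := Fact.mk hp
  have h0 : ((p : ℕ) : R ⧸ P) = 0 := by
    rw [← map_natCast (Ideal.Quotient.mk P), Ideal.Quotient.eq_zero_iff_mem]; exact hpP
  haveI : CharP (R ⧸ P) p := (CharP.charP_iff_prime_eq_zero hp).mpr h0
  letI := ZMod.algebra (R ⧸ P) p
  set y := Ideal.Quotient.mk P x with hy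
  have hc0 : c ≠ 0 := by
    rintro rfl
    have hq0 : q ≠ 0 := by
      rintro rfl
      have := hp.two_le
      simp at hq1; omega
    rw [zero_pow hq0] at hc
    exact hm ((ZMod.natCast_eq_zero_iff _ _).mp hc.symm)
  have hyq : y ^ q = algebraMap (ZMod p) (R ⧸ P) (c ^ q) := by
    rw [hc, map_natCast, hy, ← map_pow, hx, map_natCast]
  have hy1 : y ^ (p - 1) = 1 := by
    obtain ⟨t, ht⟩ := hq1
    rw [ht, pow_mul, hyq, ← map_pow, ← pow_mul, ← ht, ZMod.pow_card_sub_one_eq_one hc0, map_one]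
  have hyp : y ^ p - y = 0 := by
    conv_lhs => rw [← Nat.succ_pred_eq_of_pos hp.pos]
    rw [Nat.succ_eq_add_one, pow_succ, Nat.pred_eq_sub_one, hy1]; simp
  have hpoly : (Polynomial.X ^ p - Polynomial.X : Polynomial (ZMod p)) =
      ∏ a : ZMod p, (Polynomial.X - Polynomial.C a) := by
    have hr := FiniteField.roots_X_pow_card_sub_X (ZMod p)
    rw [ZMod.card] at hr
    have hd := FiniteField.X_pow_card_sub_X_natDegree_eq (ZMod p) hp.one_lt
    have hm : (Polynomial.X ^ p - Polynomial.X : Polynomial (ZMod p)).Monic :=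
      Polynomial.monic_X_pow_sub (by
        rw [Polynomial.degree_X]; exact_mod_cast hp.one_lt)
    have := Polynomial.prod_multiset_X_sub_C_of_monic_of_roots_card_eq hm (by
      rw [hr, hd, ← Finset.card_def, Finset.card_univ, ZMod.card])
    rw [hr] at this
    exact this.symm
  have h1 := congrArg (Polynomial.aeval y) hpoly
  simp only [map_sub, map_pow, Polynomial.aeval_X, map_prod, Polynomial.aeval_C] at h1
  rw [hyp] at h1
  obtain ⟨a, -, ha⟩ := Finset.prod_eq_zero_iff.mp h1.symm
  refine ⟨a.val, ?_⟩
  rw [← Ideal.Quotient.eq_zero_iff_mem, map_sub, map_natCast, ← hy, ← ha]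
  congr 1
  conv_rhs => rw [← ZMod.natCast_zmod_val a]
  rw [map_natCast]

theorem roots_eq_of_sub_mem {R : Type*} [CommRing R] [IsDomain R] (P : Ideal R) [hP : P.IsPrime]
    (p q m : ℕ) (hq : 0 < q)
    (hp : p.Prime) (hpP : (p : R) ∈ P) (x y : R) (hx : x ^ q = m) (hy : y ^ q = m)
    (hm : ¬ p ∣ m) (hpq : ¬ p ∣ q) (h : x - y ∈ P) : x = y := by
  by_contra hne
  have hnat : ∀ n : ℕ, (n : R) ∈ P → p ∣ n := by
    intro n hn
    by_contra hnd
    have hcop : IsCoprime (p : ℤ) (n : ℤ) :=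
      Nat.isCoprime_iff_coprime.mpr ((Nat.Prime.coprime_iff_not_dvd hp).mpr hnd)
    obtain ⟨a, b, hab⟩ := hcop
    apply hP.ne_top
    rw [Ideal.eq_top_iff_one]
    have h1 : ((a : R) * p + b * n) = 1 := by exact_mod_cast congrArg (Int.cast : ℤ → R) hab
    rw [← h1]
    exact P.add_mem (P.mul_mem_left _ hpP) (P.mul_mem_left _ hn)
  have h1 : (∑ i ∈ range q, x ^ i * y ^ (q - 1 - i)) * (x - y) = 0 := by
    rw [(Commute.all x y).geom_sum₂_mul, hx, hy, sub_self]
  have h2 := (mul_eq_zero.mp h1).resolve_right (sub_ne_zero.mpr hne)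
  have hxy : Ideal.Quotient.mk P x = Ideal.Quotient.mk P y := Ideal.Quotient.eq.mpr h
  have h3 : Ideal.Quotient.mk P ((q : R) * y ^ (q - 1)) = 0 := by
    rw [← map_zero (Ideal.Quotient.mk P), ← h2, map_sum]
    rw [Finset.sum_congr rfl (g := fun _ => Ideal.Quotient.mk P y ^ (q - 1))]
    · rw [Finset.sum_const, card_range, nsmul_eq_mul, map_mul, map_natCast, map_pow]
    · intro i hi
      rw [map_mul, map_pow, map_pow, hxy, ← pow_add]
      congr 1
      have := Finset.mem_range.mp hi
      omega
  rw [Ideal.Quotient.eq_zero_iff_mem] at h3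
  rcases hP.mem_or_mem h3 with h4 | h4
  · exact hpq (hnat _ h4)
  · have h5 := hP.mem_of_pow_mem _ h4
    apply hm
    apply hnat
    rw [← hy]
    exact P.pow_mem_of_mem h5 q hq

open NumberField in
theorem E_split (E : Type*) [Field E] [NumberField E] [IsGalois ℚ E] (q : ℕ) (hq : 0 < q)
    (X : Set (𝓞 E))
    (hX : ∀ τ τ' : E ≃ₐ[ℚ] E, (∀ x ∈ X, τ (x : E) = τ' (x : E)) → τ = τ')
    (p : ℕ) (hp : p.Prime) (hpq : ¬ p ∣ q) (hq1 : q ∣ p - 1)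
    (hX2 : ∀ x ∈ X, ∃ m : ℕ, x ^ q = m ∧ ¬ p ∣ m ∧ ∃ c : ZMod p, c ^ q = m) :
    ∃ T : Finset (Ideal (𝓞 E)), T.card = Module.finrank ℚ E ∧
      ∀ P ∈ T, P.IsPrime ∧ Ideal.absNorm P = p := by
  classical
  obtain ⟨P, hPmax, hPle⟩ : ∃ P : Ideal (𝓞 E), P.IsMaximal ∧ Ideal.span {(p : 𝓞 E)} ≤ P := by
    apply Ideal.exists_le_maximal
    rw [Ne, ← Ideal.absNorm_eq_one_iff, Ideal.absNorm_span_natCast]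
    exact (Nat.one_lt_pow (Module.finrank_pos (R := ℤ) (M := 𝓞 E)).ne' hp.one_lt).ne'
  have hpP : (p : 𝓞 E) ∈ P := hPle (Ideal.mem_span_singleton_self _)
  haveI hPp : P.IsPrime := hPmax.isPrime
  let F : (E ≃ₐ[ℚ] E) → Ideal (𝓞 E) :=
    fun τ => P.comap (RingOfIntegers.mapRingEquiv (τ : E ≃+* E))
  have hFp : ∀ τ, (F τ).IsPrime := fun τ => Ideal.comap_isPrime _ _
  have hFm : ∀ τ, (p : 𝓞 E) ∈ F τ := fun τ => by
    simp only [F, Ideal.mem_comap, map_natCast]; exact hpP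
  have hinj : Function.Injective F := by
    intro τ τ' h
    apply hX
    intro x hx
    obtain ⟨m, hxm, hpm, c, hc⟩ := hX2 x hx
    haveI := hFp τ
    obtain ⟨a, ha⟩ := exists_nat_sub_mem (F τ) p q m hp (hFm τ) x hxm c hc hpm hq1
    have ha' : x - (a : 𝓞 E) ∈ F τ' := h ▸ ha
    simp only [F, Ideal.mem_comap, map_sub, map_natCast] at ha ha'
    have hd := P.sub_mem ha ha'
    rw [sub_sub_sub_cancel_right] at hd
    have := roots_eq_of_sub_mem P p q m hq hp hpP _ _
      (by rw [← map_pow, hxm, map_natCast]) (by rw [← map_pow, hxm, map_natCast]) hpm hpq hd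
    exact congrArg (fun z : 𝓞 E => (z : E)) this
  let T := Finset.univ.image F
  have hTc : T.card = Module.finrank ℚ E := by
    rw [Finset.card_image_of_injective _ hinj, Finset.card_univ, ← Nat.card_eq_fintype_card]
    exact IsGalois.card_aut_eq_finrank ℚ E
  have hT : ∀ Q ∈ T, Q.IsPrime ∧ (p : 𝓞 E) ∈ Q := by
    intro Q hQ
    obtain ⟨τ, -, rfl⟩ := Finset.mem_image.mp hQ
    exact ⟨hFp τ, hFm τ⟩
  refine ⟨T, hTc, fun Q hQ => ⟨(hT Q hQ).1, ?_⟩⟩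
  obtain ⟨h1, h2, -⟩ := card_primes_le p hp T hT
  by_contra hne
  have hlt : ∏ Q ∈ T, p < ∏ Q ∈ T, Ideal.absNorm Q :=
    Finset.prod_lt_prod (fun _ _ => hp.pos) h2 ⟨Q, hQ, lt_of_le_of_ne (h2 Q hQ) (Ne.symm hne)⟩
  rw [Finset.prod_const, hTc, ← RingOfIntegers.rank] at hlt
  omega

open NumberField in
theorem exists_hom_zmod (K : Type*) [Field K] [NumberField K] (P : Ideal (𝓞 K))
    (h : (Ideal.absNorm P).Prime) : Nonempty (𝓞 K →+* ZMod (Ideal.absNorm P)) := by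
  have hfin : Finite (𝓞 K ⧸ P) := by
    rw [← Ideal.absNorm_ne_zero_iff]; exact h.ne_zero
  letI := Fintype.ofFinite (𝓞 K ⧸ P)
  have hc : Fintype.card (𝓞 K ⧸ P) = Ideal.absNorm P := by
    rw [Ideal.absNorm_apply, Submodule.cardQuot_apply, Nat.card_eq_fintype_card]
  exact ⟨(ZMod.ringEquivOfPrime _ h hc).symm.toRingHom.comp (Ideal.Quotient.mk P)⟩

theorem dvd_sub_one_of_root (p q : ℕ) (hp : p.Prime) (hq : q.Prime) (hpq : ¬ p ∣ q) (z : ZMod p)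
    (hz : ∑ i ∈ range q, z ^ i = 0) : q ∣ p - 1 := by
  haveI := Fact.mk hp
  have h1 : z ^ q = 1 := by
    have := geom_sum_mul z q
    rw [hz, zero_mul] at this
    exact (sub_eq_zero.mp this.symm)
  have h2 : z ≠ 1 := by
    rintro rfl
    simp at hz
    exact hpq ((ZMod.natCast_eq_zero_iff _ _).mp hz)
  haveI := Fact.mk hq
  have h3 : orderOf z = q := orderOf_eq_prime h1 h2
  rw [← h3]
  have hz0 : z ≠ 0 := by rintro rfl; simp [hq.ne_zero] at h1
  exact orderOf_dvd_of_pow_eq_one (ZMod.pow_card_sub_one_eq_one hz0)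

theorem pow_val_add {R : Type*} [Monoid R] (z : R) (q : ℕ) [NeZero q] (hz : z ^ q = 1)
    (a b : ZMod q) : z ^ (a + b).val = z ^ a.val * z ^ b.val := by
  rw [ZMod.val_add, ← pow_add]
  exact (pow_eq_pow_mod _ hz).symm

theorem pow_val_cast {R : Type*} [Monoid R] (z : R) (q : ℕ) [NeZero q] (hz : z ^ q = 1)
    (a : ℕ) : z ^ (a : ZMod q).val = z ^ a := by
  rw [ZMod.val_natCast]
  exact (pow_eq_pow_mod _ hz).symm

theorem norm_step (F : Type*) [Field F] [NumberField F] (q n : ℕ) (hq : q.Prime)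
    (ht : ¬ q ∣ Module.finrank ℚ F) (ps : Fin n → ℕ) (hps : ∀ i, (ps i).Prime)
    (hinj : Function.Injective ps) (e : Fin n → ℕ) (d : F)
    (hd : d ^ q = ((∏ i, ps i ^ e i : ℕ) : F)) (j : Fin n) : q ∣ e j := by
  have h1 := congrArg (Algebra.norm ℚ) hd
  rw [map_pow, ← map_natCast (algebraMap ℚ F), Algebra.norm_algebraMap] at h1
  have := Fact.mk (hps j)
  have hne : ∀ i, ((ps i : ℕ)) ^ e i ≠ 0 := fun i => pow_ne_zero _ (hps i).ne_zero
  have hne' : (∏ i, ps i ^ e i : ℕ) ≠ 0 := Finset.prod_ne_zero_iff.mpr fun i _ => hne i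
  have hnd : Algebra.norm ℚ d ≠ 0 := by
    intro h0
    rw [h0, zero_pow hq.ne_zero] at h1
    exact pow_ne_zero _ (Nat.cast_ne_zero.mpr hne') h1.symm
  have h2 := congrArg (padicValRat (ps j)) h1
  rw [padicValRat.pow, padicValRat.pow,
    padicValRat.of_nat, ← Nat.factorization_def _ (hps j),
    Nat.factorization_prod (fun i _ => hne i)] at h2
  rw [Finsupp.finsetSum_apply, Finset.sum_eq_single j] at h2
  · rw [Nat.factorization_pow, Finsupp.smul_apply, (hps j).factorization_self] at h2
    have h3 : (q : ℤ) ∣ ((Module.finrank ℚ F * e j : ℕ) : ℤ) := by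
      refine ⟨padicValRat (ps j) (Algebra.norm ℚ d), ?_⟩
      rw [h2]
      simp
    exact (hq.dvd_mul.mp (Int.natCast_dvd_natCast.mp h3)).resolve_left ht
  · intro i _ hij
    rw [Nat.factorization_pow, Finsupp.smul_apply, (hps i).factorization,
      Finsupp.single_eq_of_ne (fun h => hij (hinj h.symm)), smul_zero]
  · simp

open IntermediateField in
theorem exists_sigma (E : Type*) [Field E] [NumberField E] [IsGalois ℚ E] (q n : ℕ)
    (hq : q.Prime) (ζ : E) (hζ : IsPrimitiveRoot ζ q) (ps : Fin n → ℕ)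
    (hps : ∀ i, (ps i).Prime) (hinj : Function.Injective ps) (β : Fin n → E)
    (hβ : ∀ i, β i ^ q = ps i) (f : Fin n → ZMod q) :
    ∃ σ : E ≃ₐ[ℚ] E, σ ζ = ζ ∧ ∀ i, σ (β i) = ζ ^ (f i).val * β i := by
  have hqF := Fact.mk hq
  have hβ0 : ∀ i, β i ≠ 0 := by
    intro i h
    have := hβ i
    rw [h, zero_pow hq.ne_zero] at this
    exact (hps i).ne_zero (by exact_mod_cast this.symm)
  let H : AddSubgroup (Fin n → ZMod q) :=
  { carrier := {f | ∃ σ : E ≃ₐ[ℚ] E, σ ζ = ζ ∧ ∀ i, σ (β i) = ζ ^ (f i).val * β i}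
    zero_mem' := ⟨AlgEquiv.refl, rfl, fun i => by simp⟩
    add_mem' := by
      rintro a b ⟨σ, hσ, ha⟩ ⟨τ, hτ, hb⟩
      refine ⟨τ.trans σ, by simp [hσ, hτ], fun i => ?_⟩
      rw [AlgEquiv.trans_apply, hb, map_mul, map_pow, hσ, ha, Pi.add_apply,
        pow_val_add ζ q hζ.pow_eq_one]
      ring
    neg_mem' := by
      rintro a ⟨σ, hσ, ha⟩
      have hs : σ.symm ζ = ζ := by rw [AlgEquiv.symm_apply_eq, hσ]
      refine ⟨σ.symm, hs, fun i => ?_⟩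
      rw [AlgEquiv.symm_apply_eq, map_mul, map_pow, hσ, ha, ← mul_assoc, Pi.neg_apply,
        ← pow_val_add ζ q hζ.pow_eq_one, neg_add_cancel, ZMod.val_zero, pow_zero, one_mul] }
  suffices hT : AddSubgroup.toZModSubmodule q H = ⊤ by
    have : f ∈ AddSubgroup.toZModSubmodule q H := by rw [hT]; trivial
    exact this
  by_contra hne
  obtain ⟨g, hg0, hg⟩ := Submodule.exists_le_ker_of_lt_top _ (lt_top_iff_ne_top.mpr hne)
  let e : Fin n → ZMod q := fun i => g (Pi.single i 1)
  have hge : ∀ v, g v = ∑ i, v i * e i := by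
    intro v
    conv_lhs => rw [← Finset.univ_sum_single v]
    rw [map_sum]
    refine Finset.sum_congr rfl fun i _ => ?_
    rw [show (Pi.single i (v i) : Fin n → ZMod q) = v i • Pi.single i 1 by
      rw [← Pi.single_smul, smul_eq_mul, mul_one], map_smul, smul_eq_mul]
  have hpow1 : ∀ a : E, a ^ q = 1 → ∃ c : ZMod q, a = ζ ^ c.val := by
    intro a ha
    obtain ⟨j, hj, h⟩ := hζ.eq_pow_of_pow_eq_one ha
    exact ⟨j, by rw [ZMod.val_natCast, Nat.mod_eq_of_lt hj, h]⟩
  let b : E := ∏ i, β i ^ (e i).val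
  have hb : b ∈ ℚ⟮ζ⟯ := by
    rw [← IsGalois.fixedField_fixingSubgroup ℚ⟮ζ⟯, mem_fixedField_iff]
    intro σ hσ
    have hσζ : σ ζ = ζ := (mem_fixingSubgroup_iff _ _).mp hσ ζ (mem_adjoin_simple_self ℚ ζ)
    have : ∀ i, ∃ c : ZMod q, σ (β i) = ζ ^ c.val * β i := by
      intro i
      obtain ⟨c, hc⟩ := hpow1 (σ (β i) / β i) (by
        rw [div_pow, ← map_pow, hβ, map_natCast, div_self]
        exact_mod_cast (hps i).ne_zero)
      exact ⟨c, by rw [← hc, div_mul_cancel₀ _ (hβ0 i)]⟩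
    choose c hc using this
    have hcH : c ∈ AddSubgroup.toZModSubmodule q H := ⟨σ, hσζ, hc⟩
    have hgc : g c = 0 := hg hcH
    rw [hge] at hgc
    simp only [b, map_prod, map_pow, hc, mul_pow]
    rw [Finset.prod_mul_distrib]
    have : ∏ i, (ζ ^ (c i).val) ^ (e i).val = 1 := by
      simp only [← pow_mul]
      rw [Finset.prod_pow_eq_pow_sum, ← pow_val_cast ζ q hζ.pow_eq_one]
      push_cast
      simp only [ZMod.natCast_val, ZMod.cast_id', id_eq]
      rw [hgc]; simp
    rw [this, one_mul]
  have hfin : Module.finrank ℚ ℚ⟮ζ⟯ = q - 1 := by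
    rw [adjoin.finrank (Algebra.IsIntegral.isIntegral ζ),
      ← Polynomial.cyclotomic_eq_minpoly_rat hζ hq.pos, Polynomial.natDegree_cyclotomic,
      Nat.totient_prime hq]
  have hdvd := norm_step ℚ⟮ζ⟯ q n hq (by
    rw [hfin]
    exact Nat.not_dvd_of_pos_of_lt (Nat.sub_pos_of_lt hq.one_lt) (Nat.sub_lt hq.pos one_pos))
    ps hps hinj (fun i => (e i).val) ⟨b, hb⟩ (by
      apply Subtype.ext
      push_cast
      simp only [b]
      rw [← Finset.prod_pow]
      refine Finset.prod_congr rfl fun i _ => ?_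
      rw [← pow_mul, mul_comm, pow_mul, hβ])
  apply hg0
  ext v
  rw [LinearMap.zero_comp, LinearMap.zero_apply, LinearMap.comp_apply]
  have : e v = 0 := by
    rw [← ZMod.val_eq_zero]
    exact Nat.eq_zero_of_dvd_of_lt (hdvd v) (ZMod.val_lt _)
  exact this

open NumberField Polynomial in
theorem core_aux (E : Type) [Field E] [NumberField E] [IsGalois ℚ E] (q n : ℕ)
    (hq : q.Prime) (ζ : E) (hζ : IsPrimitiveRoot ζ q) (ps : Fin n → ℕ)
    (hps : ∀ i, (ps i).Prime) (hinj : Function.Injective ps) (β : Fin n → E)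
    (hβ : ∀ i, β i ^ q = ps i)
    (hX : ∀ τ τ' : E ≃ₐ[ℚ] E, (∀ x : E, (x ^ q = 1 ∨ ∃ i, x ^ q = ps i) → τ x = τ' x) → τ = τ')
    (f : Fin n → ZMod q) (hf : f ≠ 0) (M : ℕ) (hM : 0 < M) :
    ∃ p, p.Prime ∧ ¬ p ∣ M ∧ q ∣ p - 1 ∧
      (∀ e : Fin n → ℕ, ∑ i, (e i : ZMod q) * f i = 0 →
        ∃ y : ZMod p, y ^ q = ∏ i, (ps i : ZMod p) ^ (e i)) ∧
      ¬ ∀ i, ∃ y : ZMod p, y ^ q = ps i := by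
  classical
  have hqF := Fact.mk hq
  obtain ⟨σ, hσζ, hσβ⟩ := exists_sigma E q n hq ζ hζ ps hps hinj β hβ f
  have hβ0 : ∀ i, β i ≠ 0 := by
    intro i h
    have := hβ i
    rw [h, zero_pow hq.ne_zero] at this
    exact (hps i).ne_zero (by exact_mod_cast this.symm)
  have hσ1 : σ ≠ 1 := by
    rintro rfl
    apply hf
    funext i
    have h1 := hσβ i
    rw [AlgEquiv.one_apply] at h1
    have h2 : ζ ^ (f i).val = 1 := by
      apply mul_right_cancel₀ (hβ0 i)
      rw [← h1, one_mul]
    have := (hζ.pow_eq_one_iff_dvd _).mp h2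
    rw [Pi.zero_apply, ← ZMod.val_eq_zero]
    exact Nat.eq_zero_of_dvd_of_lt this (ZMod.val_lt _)
  by_contra hcon
  push Not at hcon
  let K := IntermediateField.fixedField (Subgroup.zpowers σ)
  have hKmem : ∀ x : E, σ x = x → x ∈ K := by
    intro x hx
    rw [IntermediateField.mem_fixedField_iff]
    intro τ hτ
    have : Subgroup.zpowers σ ≤ MulAction.stabilizer (E ≃ₐ[ℚ] E) x := by
      rw [Subgroup.zpowers_le]; exact hx
    exact this hτ
  have hfin : 2 * Module.finrank ℚ K ≤ Module.finrank ℚ E := by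
    rw [← Module.finrank_mul_finrank ℚ K E, mul_comm]
    apply Nat.mul_le_mul_left
    rw [IntermediateField.finrank_fixedField_eq_card]
    have : Nontrivial (Subgroup.zpowers σ) := by
      rw [Subgroup.nontrivial_iff_ne_bot, Ne, Subgroup.zpowers_eq_bot]
      exact hσ1
    exact Finite.one_lt_card
  let M' := M * q * ∏ i, ps i
  have hM' : M' ≠ 0 := mul_ne_zero (mul_ne_zero hM.ne' hq.ne_zero)
    (Finset.prod_ne_zero_iff.mpr fun i _ => (hps i).ne_zero)
  let A : Set ℕ := {p | p.Prime ∧ ¬ p ∣ M' ∧ q ∣ p - 1 ∧ ∀ i, ∃ y : ZMod p, y ^ q = ps i}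
  have hqM : q ∣ M' := Dvd.intro_left _ rfl |>.trans (Dvd.intro _ rfl)
  have hMM : M ∣ M' := (Dvd.intro _ rfl).trans (Dvd.intro _ rfl)
  have hpsM : ∀ i, ps i ∣ M' := fun i =>
    (Finset.dvd_prod_of_mem _ (Finset.mem_univ i)).trans (Dvd.intro_left _ rfl)
  refine zeta_compare K E A (fun p hp => hp.1) M' hM' ?_ (Module.finrank ℚ E) hfin ?_
  · intro P hP
    by_contra hPA
    rw [not_or] at hPA
    obtain ⟨hPA, hPM⟩ := hPA
    apply hPA
    obtain ⟨ψ⟩ := exists_hom_zmod K P hP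
    set p := Ideal.absNorm P with hpdef
    have hpq : ¬ p ∣ q := fun h => hPM (h.trans hqM)
    have hInt : ∀ (x : E) (m : ℕ), x ^ q = m → IsIntegral ℤ x := by
      intro x m hx
      apply IsIntegral.of_pow hq.pos
      rw [hx]
      exact isIntegral_natCast _
    have hlift : ∀ (x : E) (m : ℕ), x ^ q = m → σ x = x →
        ∃ y : 𝓞 K, ((y : K) : E) = x := by
      intro x m hx hσx
      refine ⟨⟨⟨x, hKmem x hσx⟩, ?_⟩, rfl⟩
      have h := hInt x m hx
      have : IsIntegral ℤ (algebraMap K E ⟨x, hKmem x hσx⟩) := h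
      exact (isIntegral_algebraMap_iff (algebraMap K E).injective).mp this
    have hcoe : Function.Injective (fun y : 𝓞 K => ((y : K) : E)) :=
      Subtype.val_injective.comp RingOfIntegers.coe_injective
    have hq1 : q ∣ p - 1 := by
      obtain ⟨z, hz⟩ := hlift ζ 1 (by rw [hζ.pow_eq_one, Nat.cast_one]) hσζ
      apply dvd_sub_one_of_root p q hP hq hpq (ψ z)
      have : ∑ i ∈ range q, z ^ i = 0 := by
        apply hcoe
        have := hζ.geom_sum_eq_zero hq.one_lt
        simpa [hz] using this
      simpa using congrArg ψ this
    refine ⟨hP, hPM, hq1, ?_⟩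
    refine hcon p hP (fun h => hPM (h.trans hMM)) hq1 ?_
    intro e he
    have hb : (∏ i, β i ^ e i) ^ q = ((∏ i, ps i ^ e i : ℕ) : E) := by
      push_cast
      rw [← Finset.prod_pow]
      refine Finset.prod_congr rfl fun i _ => ?_
      rw [← pow_mul, mul_comm, pow_mul, hβ]
    obtain ⟨y, hy⟩ := hlift (∏ i, β i ^ e i) _ hb (by
      simp only [map_prod, map_pow, hσβ, mul_pow]
      rw [Finset.prod_mul_distrib]
      have : ∏ i, (ζ ^ (f i).val) ^ (e i) = 1 := by
        simp only [← pow_mul]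
        rw [Finset.prod_pow_eq_pow_sum, ← pow_val_cast ζ q hζ.pow_eq_one]
        push_cast
        simp only [ZMod.natCast_val, ZMod.cast_id', id_eq]
        rw [Finset.sum_congr rfl (fun i _ => mul_comm _ _), he]; simp
      rw [this, one_mul])
    refine ⟨ψ y, ?_⟩
    have h1 : y ^ q = ((∏ i, ps i ^ e i : ℕ) : 𝓞 K) := by
      apply hcoe
      simp only
      rw [← hy] at hb
      push_cast
      push_cast at hb
      exact hb
    rw [← map_pow, h1, map_natCast]
    push_cast
    rfl
  · rintro p ⟨hp, hpM, hq1, hpow⟩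
    refine E_split E q hq.pos {x | (x : E) ^ q = 1 ∨ ∃ i, (x : E) ^ q = ps i} ?_ p hp
      (fun h => hpM (h.trans hqM)) hq1 ?_
    · intro τ τ' h
      apply hX
      intro x hx
      have hInt : IsIntegral ℤ x := by
        apply IsIntegral.of_pow hq.pos
        rcases hx with hx | ⟨i, hx⟩
        · rw [hx]; exact isIntegral_one
        · rw [hx]; exact isIntegral_natCast _
      exact h ⟨x, hInt⟩ hx
    · rintro x (hx | ⟨i, hx⟩)
      · refine ⟨1, ?_, hp.one_lt.ne' ∘ Nat.dvd_one.mp, 1, by simp⟩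
        apply RingOfIntegers.coe_injective
        simpa using hx
      · refine ⟨ps i, ?_, fun h => hpM (h.trans (hpsM i)), hpow i⟩
        apply RingOfIntegers.coe_injective
        simpa using hx

open Polynomial in
theorem exists_split (g : ℚ[X]) : ∃ (E : Type) (_ : Field E) (_ : CharZero E),
    IsSplittingField ℚ E g := by
  have h : CharZero g.SplittingField := algebraRat.charZero _
  refine ⟨g.SplittingField, inferInstance, h, ?_⟩
  have := IsSplittingField.splittingField g
  convert this
  exact Subsingleton.elim _ _

set_option maxHeartbeats 1000000 in
open Polynomial in
theorem core_split (E : Type) [Field E] [CharZero E] (q n : ℕ) (hq : q.Prime) (ps : Fin n → ℕ)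
    (g : ℚ[X]) (hg : g = (X ^ q - 1) * ∏ i, (X ^ q - C (ps i : ℚ))) [IsSplittingField ℚ E g]
    (hps : ∀ i, (ps i).Prime) (hinj : Function.Injective ps)
    (f : Fin n → ZMod q) (hf : f ≠ 0) (M : ℕ) (hM : 0 < M) :
    ∃ p, p.Prime ∧ ¬ p ∣ M ∧ q ∣ p - 1 ∧
      (∀ e : Fin n → ℕ, ∑ i, (e i : ZMod q) * f i = 0 →
        ∃ y : ZMod p, y ^ q = ∏ i, (ps i : ZMod p) ^ (e i)) ∧
      ¬ ∀ i, ∃ y : ZMod p, y ^ q = ps i := by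
  classical
  have hg1 : (X ^ q - 1 : ℚ[X]) ≠ 0 := (monic_X_pow_sub_C (1 : ℚ) hq.ne_zero).ne_zero
  have hg2 : ∀ i, (X ^ q - C (ps i : ℚ) : ℚ[X]) ≠ 0 :=
    fun i => (monic_X_pow_sub_C _ hq.ne_zero).ne_zero
  have hg0 : g ≠ 0 := by
    rw [hg]; exact mul_ne_zero hg1 (Finset.prod_ne_zero_iff.mpr fun i _ => hg2 i)
  have hNF : NumberField E := { to_charZero := inferInstance, to_finiteDimensional := IsSplittingField.finiteDimensional E g }
  have hn : Normal ℚ E := Normal.of_isSplittingField g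
  have hG : IsGalois ℚ E := ⟨⟩
  have hs : (g.map (algebraMap ℚ E)).Splits := IsSplittingField.splits E g
  have hd1 : (X ^ q - 1 : ℚ[X]) ∣ g := by rw [hg]; exact Dvd.intro _ rfl
  have hd2 : ∀ i, (X ^ q - C (ps i : ℚ) : ℚ[X]) ∣ g := fun i => by
    rw [hg]
    exact (Finset.dvd_prod_of_mem (fun i => (X ^ q - C (ps i : ℚ) : ℚ[X]))
      (Finset.mem_univ i)).trans (dvd_mul_left _ _)
  have hs1 : ((X ^ q - 1 : ℚ[X]).map (algebraMap ℚ E)).Splits :=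
    hs.of_dvd (Polynomial.map_ne_zero hg0) (Polynomial.map_dvd _ hd1)
  have hs2 : ∀ i, ((X ^ q - C (ps i : ℚ)).map (algebraMap ℚ E)).Splits := fun i =>
    hs.of_dvd (Polynomial.map_ne_zero hg0) (Polynomial.map_dvd _ (hd2 i))
  have hβ : ∀ i, ∃ b : E, b ^ q = ps i := by
    intro i
    have hd : ((X ^ q - C (ps i : ℚ)).map (algebraMap ℚ E)).degree ≠ 0 := by
      rw [degree_map, degree_X_pow_sub_C hq.pos]
      exact_mod_cast hq.ne_zero
    obtain ⟨b, hb⟩ := (hs2 i).exists_eval_eq_zero hd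
    refine ⟨b, ?_⟩
    simpa [sub_eq_zero] using hb
  choose β hβ using hβ
  have hζ : ∃ z : E, IsPrimitiveRoot z q := by
    have hc : ((cyclotomic q ℚ).map (algebraMap ℚ E)).Splits :=
      hs1.of_dvd (Polynomial.map_ne_zero hg1) (Polynomial.map_dvd _ (cyclotomic.dvd_X_pow_sub_one q ℚ))
    obtain ⟨b, hb⟩ := hc.exists_eval_eq_zero (by
      rw [degree_map]
      exact (degree_cyclotomic_pos q ℚ hq.pos).ne')
    refine ⟨b, ?_⟩
    have : NeZero (q : E) := ⟨by exact_mod_cast hq.ne_zero⟩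
    rw [← isRoot_cyclotomic_iff, ← map_cyclotomic q (algebraMap ℚ E)]
    exact hb
  obtain ⟨ζ, hζ⟩ := hζ
  refine core_aux E q n hq ζ hζ ps hps hinj β hβ ?_ f hf M hM
  intro τ τ' h
  have hadj := IsSplittingField.adjoin_rootSet E g
  have : (τ : E →ₐ[ℚ] E) = τ' := by
    apply AlgHom.ext_of_adjoin_eq_top hadj
    intro x hx
    apply h
    rw [mem_rootSet] at hx
    have hx2 := hx.2
    simp only [hg, map_mul, map_prod, mul_eq_zero, Finset.prod_eq_zero_iff] at hx2
    rcases hx2 with hx2 | ⟨i, -, hx2⟩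
    · left; simpa [sub_eq_zero] using hx2
    · right; exact ⟨i, by simpa [sub_eq_zero] using hx2⟩
  ext x
  exact DFunLike.congr_fun this x

open Polynomial in
theorem core (q n : ℕ) (hq : q.Prime) (ps : Fin n → ℕ)
    (hps : ∀ i, (ps i).Prime) (hinj : Function.Injective ps)
    (f : Fin n → ZMod q) (hf : f ≠ 0) (M : ℕ) (hM : 0 < M) :
    ∃ p, p.Prime ∧ ¬ p ∣ M ∧ q ∣ p - 1 ∧
      (∀ e : Fin n → ℕ, ∑ i, (e i : ZMod q) * f i = 0 →
        ∃ y : ZMod p, y ^ q = ∏ i, (ps i : ZMod p) ^ (e i)) ∧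
      ¬ ∀ i, ∃ y : ZMod p, y ^ q = ps i := by
  obtain ⟨E, i1, i2, i3⟩ := exists_split ((X ^ q - 1) * ∏ i, (X ^ q - C (ps i : ℚ)) : ℚ[X])
  exact core_split E q n hq ps _ rfl hps hinj f hf M hM

theorem geom_strictMono (q : ℕ) (hq : 0 < q) :
    StrictMono (fun n => ∑ i ∈ Finset.range n, q ^ i) := by
  apply strictMono_nat_of_lt_succ
  intro n
  rw [Finset.sum_range_succ]
  have : 0 < q ^ n := by positivity
  omega

section BB
variable {F V α : Type*} [Field F] [Finite F] [AddCommGroup V] [Module F V] [FiniteDimensional F V]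

theorem bb_avoid (k : ℕ) (S : Finset α) (v : α → V)
    (hcard : S.card = ∑ i ∈ Finset.range (k + 1), (Nat.card F) ^ i)
    (hblock : ∀ U : Submodule F V, Module.finrank F V ≤ Module.finrank F U + k → ∃ s ∈ S, v s ∈ U)
    (U₀ : Submodule F V) (hU₀ : ∀ s ∈ S, v s ∉ U₀) (s t : α) (hs : s ∈ S) (ht : t ∈ S)
    (hst : s ≠ t) (c : F) (hc : v s + c • v t ∈ U₀) : False := by
  classical
  have : Finite V := Module.finite_of_finite F
  obtain ⟨U, hU₀U, hU⟩ := Set.Finite.exists_le_maximal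
    (Set.toFinite {U : Submodule F V | ∀ s ∈ S, v s ∉ U}) hU₀
  have hUa : ∀ s ∈ S, v s ∉ U := hU.prop
  have hne : ∀ s : S, U.mkQ (v s) ≠ 0 := by
    intro s h
    rw [Submodule.mkQ_apply, Submodule.Quotient.mk_eq_zero] at h
    exact hUa s s.2 h
  let g : S → Projectivization F (V ⧸ U) := fun s => Projectivization.mk F (U.mkQ (v s)) (hne s)
  have hsurj : Function.Surjective g := by
    intro y
    induction y using Projectivization.ind with
    | h y hy =>
      obtain ⟨u, rfl⟩ := U.mkQ_surjective y
      have huU : u ∉ U := by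
        intro h
        exact hy (by rwa [Submodule.mkQ_apply, Submodule.Quotient.mk_eq_zero])
      have hnot : ¬ (∀ s ∈ S, v s ∉ U ⊔ Submodule.span F {u}) := by
        intro h
        have := hU.le_of_ge (y := U ⊔ Submodule.span F {u}) h le_sup_left
        exact huU (this (Submodule.mem_sup_right (Submodule.mem_span_singleton_self u)))
      push Not at hnot
      obtain ⟨r, hr, hru⟩ := hnot
      obtain ⟨a, ha, b, hb, hab⟩ := Submodule.mem_sup.mp hru
      obtain ⟨d, rfl⟩ := Submodule.mem_span_singleton.mp hb
      refine ⟨⟨r, hr⟩, ?_⟩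
      simp only [g]
      rw [Projectivization.mk_eq_mk_iff']
      refine ⟨d, ?_⟩
      rw [← hab, map_add, map_smul]
      have : U.mkQ a = 0 := by rwa [Submodule.mkQ_apply, Submodule.Quotient.mk_eq_zero]
      rw [this, zero_add]
  have hdim : k + 1 ≤ Module.finrank F (V ⧸ U) := by
    by_contra h
    have h1 := Submodule.finrank_quotient_add_finrank U
    obtain ⟨s, hs, hsU⟩ := hblock U (by omega)
    exact hUa s hs hsU
  have hcP : Nat.card (Projectivization F (V ⧸ U)) =
      ∑ i ∈ Finset.range (Module.finrank F (V ⧸ U)), (Nat.card F) ^ i :=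
    Projectivization.card_of_finrank F (V ⧸ U) rfl
  have hle : Nat.card S ≤ Nat.card (Projectivization F (V ⧸ U)) := by
    rw [hcP, Nat.card_eq_fintype_card, Fintype.card_coe, hcard]
    exact (geom_strictMono _ Nat.card_pos).monotone hdim
  have hfinP : Finite (Projectivization F (V ⧸ U)) := Finite.of_surjective g hsurj
  have hinj : Function.Injective g :=
    ((Nat.bijective_iff_surjective_and_card g).mpr ⟨hsurj, le_antisymm hle
      (Nat.card_le_card_of_surjective g hsurj)⟩).1
  apply hst
  have := @hinj ⟨s, hs⟩ ⟨t, ht⟩ (by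
    simp only [g]
    rw [Projectivization.mk_eq_mk_iff']
    refine ⟨-c, ?_⟩
    have h1 : U.mkQ (v s + c • v t) = 0 := by
      rw [Submodule.mkQ_apply, Submodule.Quotient.mk_eq_zero]; exact hU₀U hc
    rw [map_add, map_smul] at h1
    rw [neg_smul]
    exact (eq_neg_of_add_eq_zero_left h1).symm)
  exact congrArg Subtype.val this

theorem bose_burton (k : ℕ) (S : Finset α) (v : α → V) (hv : ∀ s ∈ S, v s ≠ 0)
    (hcard : S.card = ∑ i ∈ Finset.range (k + 1), (Nat.card F) ^ i)
    (hblock : ∀ U : Submodule F V, Module.finrank F V ≤ Module.finrank F U + k →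
      ∃ s ∈ S, v s ∈ U) :
    ∃ W : Submodule F V, Module.finrank F W = k + 1 ∧
      {P : Submodule F V | ∃ s ∈ S, P = Submodule.span F {v s}} =
      {P | ∃ w ∈ W, w ≠ 0 ∧ P = Submodule.span F {w}} := by
  classical
  have hav := bb_avoid k S v hcard hblock
  obtain ⟨s0, hs0⟩ : S.Nonempty := by
    rw [← Finset.card_pos, hcard]
    exact Finset.sum_pos (fun i _ => pow_pos Nat.card_pos _) ⟨0, by simp⟩
  have hz : ∀ s ∈ S, ∀ t ∈ S, ∀ c : F, ∃ r ∈ S, ∃ a : F, v s + c • v t = a • v r := by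
    intro s hs t ht c
    by_cases hst : s = t
    · exact ⟨s, hs, 1 + c, by rw [← hst, add_smul, one_smul]⟩
    by_contra hcon
    push Not at hcon
    refine hav (Submodule.span F {v s + c • v t}) ?_ s t hs ht hst c
      (Submodule.mem_span_singleton_self _)
    intro r hr hmem
    obtain ⟨b, hb⟩ := Submodule.mem_span_singleton.mp hmem
    have hb0 : b ≠ 0 := by
      rintro rfl
      rw [zero_smul] at hb
      exact hv r hr hb.symm
    exact hcon r hr b⁻¹ (by rw [← hb, smul_smul, inv_mul_cancel₀ hb0, one_smul])
  let W : Submodule F V :=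
  { carrier := {w | ∃ r ∈ S, ∃ a : F, w = a • v r}
    zero_mem' := ⟨s0, hs0, 0, by simp⟩
    add_mem' := by
      rintro _ _ ⟨s, hs, a, rfl⟩ ⟨t, ht, b, rfl⟩
      by_cases ha : a = 0
      · exact ⟨t, ht, b, by simp [ha]⟩
      · obtain ⟨r, hr, d, hd⟩ := hz s hs t ht (a⁻¹ * b)
        refine ⟨r, hr, a * d, ?_⟩
        rw [mul_smul, ← hd, smul_add, smul_smul, mul_inv_cancel_left₀ ha]
    smul_mem' := by
      rintro c _ ⟨s, hs, a, rfl⟩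
      exact ⟨s, hs, c * a, by rw [mul_smul]⟩ }
  have hvW : ∀ s ∈ S, v s ∈ W := fun s hs => ⟨s, hs, 1, by simp⟩
  refine ⟨W, ?_, ?_⟩
  · let g : S → Projectivization F W := fun s =>
      Projectivization.mk F (⟨v s, hvW s s.2⟩ : W) (fun h => hv s s.2 (congrArg Subtype.val h))
    have hbij : Function.Bijective g := by
      constructor
      · intro s t h
        simp only [g] at h
        rw [Projectivization.mk_eq_mk_iff'] at h
        obtain ⟨a, ha⟩ := h
        by_contra hst
        refine hav ⊥ (fun s hs h => hv s hs h) s t s.2 t.2 (fun h => hst (Subtype.ext h)) (-a) ?_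
        have ha' : a • v t = v s := congrArg Subtype.val ha
        rw [Submodule.mem_bot, neg_smul, ha', add_neg_cancel]
      · intro y
        induction y using Projectivization.ind with
        | h y hy =>
          obtain ⟨y, r, hr, a, rfl⟩ := y
          have ha : a ≠ 0 := by
            rintro rfl
            exact hy (Subtype.ext (by simp))
          refine ⟨⟨r, hr⟩, ?_⟩
          simp only [g]
          rw [Projectivization.mk_eq_mk_iff']
          refine ⟨a⁻¹, Subtype.ext ?_⟩
          simp [smul_smul, inv_mul_cancel₀ ha]
    have h1 : Nat.card (Projectivization F W) =
        ∑ i ∈ Finset.range (Module.finrank F W), (Nat.card F) ^ i :=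
      Projectivization.card_of_finrank F W rfl
    rw [← Nat.card_eq_of_bijective g hbij, Nat.card_eq_fintype_card, Fintype.card_coe, hcard] at h1
    exact ((geom_strictMono _ Nat.card_pos).injective h1).symm
  · ext P
    constructor
    · rintro ⟨s, hs, rfl⟩
      exact ⟨v s, hvW s hs, hv s hs, rfl⟩
    · rintro ⟨_, ⟨r, hr, a, rfl⟩, hw0, rfl⟩
      have ha : a ≠ 0 := by
        rintro rfl
        exact hw0 (by simp)
      exact ⟨r, hr, Submodule.span_singleton_smul_eq (IsUnit.mk0 a ha) _⟩

end BB

theorem char_exists (p q : ℕ) (hp : p.Prime) (hq : q.Prime) :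
    ∃ χ : (ZMod p)ˣ →* Multiplicative (ZMod q), ∀ u, χ u = 1 ↔ ∃ y, y ^ q = u := by
  have := Fact.mk hp
  have := Fact.mk hq
  by_cases hd : q ∣ Nat.card (ZMod p)ˣ
  · let e : Multiplicative (ZMod (Nat.card (ZMod p)ˣ)) ≃* (ZMod p)ˣ := zmodCyclicMulEquiv inferInstance
    let c : ZMod (Nat.card (ZMod p)ˣ) →+* ZMod q := ZMod.castHom hd (ZMod q)
    refine ⟨(AddMonoidHom.toMultiplicative c.toAddMonoidHom).comp e.symm.toMonoidHom, fun u => ?_⟩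
    have h1 : ∀ a : ZMod (Nat.card (ZMod p)ˣ), c a = 0 ↔ ∃ b, q • b = a := by
      intro a
      have : NeZero (Nat.card (ZMod p)ˣ) := ⟨Nat.card_pos.ne'⟩
      constructor
      · intro h
        rw [← ZMod.natCast_zmod_val a, map_natCast, ZMod.natCast_eq_zero_iff] at h
        obtain ⟨b, hb⟩ := h
        refine ⟨b, ?_⟩
        rw [← ZMod.natCast_zmod_val a, hb]
        simp
      · rintro ⟨b, rfl⟩
        simp
    have h2 : (((AddMonoidHom.toMultiplicative c.toAddMonoidHom).comp e.symm.toMonoidHom) u = 1) ↔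
      c (e.symm u).toAdd = 0 := Iff.rfl
    rw [h2, h1]
    constructor
    · rintro ⟨b, hb⟩
      refine ⟨e (Multiplicative.ofAdd b), ?_⟩
      rw [← map_pow, ← ofAdd_nsmul, hb]
      simp
    · rintro ⟨y, rfl⟩
      exact ⟨(e.symm y).toAdd, by rw [map_pow, toAdd_pow]⟩
  · refine ⟨1, fun u => ?_⟩
    have hc : (Nat.card (ZMod p)ˣ).Coprime q :=
      Nat.coprime_comm.mp ((Nat.Prime.coprime_iff_not_dvd hq).mpr hd)
    simp only [MonoidHom.one_apply, true_iff]
    obtain ⟨y, hy⟩ := (powCoprime hc).surjective u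
    exact ⟨y, hy⟩

theorem zmod_pow_iff (p q : ℕ) (s : ℤ) :
    (∃ y : ZMod p, y ^ q = s) ↔ ∃ x : ℤ, (p : ℤ) ∣ x ^ q - s := by
  constructor
  · rintro ⟨y, hy⟩
    obtain ⟨x, rfl⟩ := ZMod.intCast_surjective y
    refine ⟨x, ?_⟩
    rw [← ZMod.intCast_zmod_eq_zero_iff_dvd]
    push_cast
    exact sub_eq_zero.mpr hy
  · rintro ⟨x, hx⟩
    refine ⟨x, ?_⟩
    have := (ZMod.intCast_zmod_eq_zero_iff_dvd _ p).mpr hx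
    push_cast at this
    exact sub_eq_zero.mp this

theorem hensel_pp (p a q : ℕ) (hp : p.Prime) (hq : q.Prime) (hpq : p ≠ q) (s : ℤ)
    (hs : ¬ (p : ℤ) ∣ s) (x : ℤ) (hx : (p : ℤ) ∣ x ^ q - s) :
    ∃ y : ℤ, ((p ^ a : ℕ) : ℤ) ∣ y ^ q - s := by
  rcases Nat.eq_zero_or_pos a with rfl | ha
  · exact ⟨0, by simp⟩
  rw [← zmod_pow_iff]
  obtain ⟨b, rfl⟩ : ∃ b, a = b + 1 := ⟨a - 1, by omega⟩
  have h1 := dvd_sub_pow_of_dvd_sub (R := ℤ) hx b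
  have hxp : ¬ (p : ℤ) ∣ x := by
    intro h
    apply hs
    have := dvd_sub (dvd_pow h hq.ne_zero) hx
    simpa using this
  have hcop : ∀ z : ℤ, ¬ (p : ℤ) ∣ z → IsUnit (z : ZMod (p ^ (b + 1))) := by
    intro z hz
    rw [ZMod.coe_int_isUnit_iff_isCoprime]
    push_cast
    exact IsCoprime.pow_left ((Prime.coprime_iff_not_dvd (Nat.prime_iff_prime_int.mp hp)).mpr hz)
  obtain ⟨u, hu⟩ := hcop s hs
  obtain ⟨w, hw⟩ := hcop x hxp
  have h2 : (w ^ q) ^ p ^ b = u ^ p ^ b := by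
    ext
    push_cast
    rw [hu, hw]
    have := (ZMod.intCast_zmod_eq_zero_iff_dvd _ (p ^ (b + 1))).mpr (by push_cast; exact h1)
    push_cast at this
    exact sub_eq_zero.mp this
  have hc : IsCoprime (q : ℤ) ((p ^ b : ℕ) : ℤ) :=
    Nat.isCoprime_iff_coprime.mpr (Nat.Coprime.pow_right _ ((Nat.coprime_primes hq hp).mpr hpq.symm))
  obtain ⟨m, n, hmn⟩ := hc
  refine ⟨((u ^ m * w ^ (n * ((p ^ b : ℕ) : ℤ)) : (ZMod (p ^ (b + 1)))ˣ) : ZMod (p ^ (b + 1))), ?_⟩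
  rw [← hu, ← Units.val_pow_eq_pow_val]
  congr 1
  have h3 : (w ^ (n * ((p ^ b : ℕ) : ℤ))) ^ q = u ^ (n * ((p ^ b : ℕ) : ℤ)) := by
    rw [mul_comm n, zpow_mul, zpow_mul, zpow_natCast, zpow_natCast, ← h2, ← zpow_natCast _ q,
      ← zpow_mul, mul_comm n, zpow_mul, zpow_natCast, ← pow_mul, ← pow_mul, mul_comm q]
  rw [mul_pow, h3, ← zpow_natCast (u ^ m), ← zpow_mul, ← zpow_add, hmn, zpow_one]

theorem hensel (N q : ℕ) (hN : 0 < N) (hq : q.Prime) (s : ℤ) (hqN : ∀ p : ℕ, p.Prime → p ∣ N → p ≠ q)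
    (hs : ∀ p : ℕ, p.Prime → p ∣ N → ¬ (p : ℤ) ∣ s)
    (hx : ∀ p : ℕ, p.Prime → p ∣ N → ∃ x : ℤ, (p : ℤ) ∣ x ^ q - s) :
    ∃ x : ℤ, (N : ℤ) ∣ x ^ q - s := by
  induction N using Nat.recOnPosPrimePosCoprime with
  | prime_pow p a hp ha =>
    have hd : p ∣ p ^ a := dvd_pow_self p ha.ne'
    obtain ⟨x, h⟩ := hx p hp hd
    exact hensel_pp p a q hp hq (hqN p hp hd) s (hs p hp hd) x h
  | zero => omega
  | one => exact ⟨0, by simp⟩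
  | coprime a b ha hb hab iha ihb =>
    obtain ⟨x, hx'⟩ := iha (by omega) (fun p hp h => hqN p hp (h.mul_right b))
      (fun p hp h => hs p hp (h.mul_right b)) (fun p hp h => hx p hp (h.mul_right b))
    obtain ⟨y, hy'⟩ := ihb (by omega) (fun p hp h => hqN p hp (h.mul_left a))
      (fun p hp h => hs p hp (h.mul_left a)) (fun p hp h => hx p hp (h.mul_left a))
    have hc : IsCoprime (a : ℤ) (b : ℤ) := Nat.isCoprime_iff_coprime.mpr hab
    obtain ⟨u, v, huv⟩ := hc
    refine ⟨x * (v * b) + y * (u * a), ?_⟩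
    push_cast
    apply IsCoprime.mul_dvd ⟨u, v, huv⟩
    · have h1 : (a : ℤ) ∣ (x * (v * b) + y * (u * a)) - x :=
        ⟨u * (y - x), by linear_combination x * huv⟩
      have := dvd_add (h1.trans (sub_dvd_pow_sub_pow _ _ q)) hx'
      simpa using this
    · have h1 : (b : ℤ) ∣ (x * (v * b) + y * (u * a)) - y :=
        ⟨v * (x - y), by linear_combination y * huv⟩
      have := dvd_add (h1.trans (sub_dvd_pow_sub_pow _ _ q)) hy'
      simpa using this

/-- the enumeration of the primes -/
def psOf (P : Finset ℕ) (i : Fin P.card) : ℕ := (P.orderIsoOfFin rfl i).1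

theorem psOf_inj (P : Finset ℕ) : Function.Injective (psOf P) :=
  Subtype.val_injective.comp (P.orderIsoOfFin rfl).injective

theorem psOf_mem (P : Finset ℕ) (i) : psOf P i ∈ P := (P.orderIsoOfFin rfl i).2

theorem mem_qPrimes (q : ℕ) (S : Finset ℤ) (p : ℕ) :
    p ∈ qPrimes q S ↔ ∃ s ∈ S, p.Prime ∧ p ∣ s.natAbs ∧ s ≠ 0 ∧ ¬ q ∣ s.natAbs.factorization p := by
  simp [qPrimes, Finset.mem_sup, and_assoc]

theorem decomp (q : ℕ) (hodd : Odd q) (S : Finset ℤ) (hS0 : ∀ s ∈ S, s ≠ 0) (s : ℤ) (hs : s ∈ S) :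
    ∃ r : ℤ, s = r ^ q * ((∏ i, psOf (qPrimes q S) i ^
      s.natAbs.factorization (psOf (qPrimes q S) i) : ℕ) : ℤ) := by
  set P := qPrimes q S with hP
  have hs0 : s.natAbs ≠ 0 := Int.natAbs_ne_zero.mpr (hS0 s hs)
  have h1 : s.natAbs = ∏ l ∈ s.natAbs.primeFactors ∪ P, l ^ s.natAbs.factorization l := by
    conv_lhs => rw [← Nat.prod_factorization_pow_eq_self hs0]
    apply Finsupp.prod_of_support_subset
    · rw [Nat.support_factorization]; exact Finset.subset_union_left
    · intros; simp
  have h2 : ∏ l ∈ P, l ^ s.natAbs.factorization l =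
      ∏ i, psOf P i ^ s.natAbs.factorization (psOf P i) := by
    rw [← Finset.prod_coe_sort]
    exact (Equiv.prod_comp (P.orderIsoOfFin rfl).toEquiv
      (fun l : P => (l : ℕ) ^ s.natAbs.factorization (l : ℕ))).symm
  have h3 : ∃ r : ℕ, ∏ l ∈ (s.natAbs.primeFactors ∪ P) \ P, l ^ s.natAbs.factorization l = r ^ q := by
    refine ⟨∏ l ∈ (s.natAbs.primeFactors ∪ P) \ P, l ^ (s.natAbs.factorization l / q), ?_⟩
    rw [← Finset.prod_pow]
    refine Finset.prod_congr rfl fun l hl => ?_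
    rw [← pow_mul]
    congr 1
    rw [Nat.div_mul_cancel]
    by_contra hnd
    rw [Finset.mem_sdiff, Finset.mem_union] at hl
    have hl1 := hl.1.resolve_right hl.2
    exact hl.2 ((mem_qPrimes q S l).mpr ⟨s, hs, Nat.prime_of_mem_primeFactors hl1,
      Nat.dvd_of_mem_primeFactors hl1, hS0 s hs, hnd⟩)
  obtain ⟨r, hr⟩ := h3
  rw [← Finset.prod_sdiff (Finset.subset_union_right (s₁ := s.natAbs.primeFactors) (s₂ := P)),
    hr, h2] at h1
  rcases Int.natAbs_eq s with h | h
  · refine ⟨r, ?_⟩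
    conv_lhs => rw [h, h1]
    push_cast; ring
  · refine ⟨-r, ?_⟩
    conv_lhs => rw [h, h1]
    rw [hodd.neg_pow]
    push_cast; ring

theorem vecOf_eq (q : ℕ) (P : Finset ℕ) (s : ℤ) :
    vecOf q P s = fun i => ((s.natAbs.factorization (psOf P i) : ℕ) : ZMod q) := rfl

theorem vecOf_ne_zero (q : ℕ) (hodd : Odd q) (S : Finset ℤ) (hS0 : ∀ s ∈ S, s ≠ 0)
    (hSpow : ∀ s ∈ S, ¬ IsPerfectPow q s) (s : ℤ) (hs : s ∈ S) :
    vecOf q (qPrimes q S) s ≠ 0 := by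
  intro h
  obtain ⟨r, hr⟩ := decomp q hodd S hS0 s hs
  have hd : ∀ i, q ∣ s.natAbs.factorization (psOf (qPrimes q S) i) := fun i =>
    (ZMod.natCast_eq_zero_iff _ _).mp (congrFun h i)
  apply hSpow s hs
  refine ⟨r * ((∏ i, psOf (qPrimes q S) i ^
      (s.natAbs.factorization (psOf (qPrimes q S) i) / q) : ℕ) : ℤ), ?_⟩
  conv_rhs => rw [hr]
  rw [mul_pow]
  congr 1
  rw [← Nat.cast_pow, ← Finset.prod_pow]
  congr 1
  refine Finset.prod_congr rfl fun i _ => ?_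
  rw [← pow_mul, Nat.div_mul_cancel (hd i)]

theorem local_functional (q : ℕ) (hq : q.Prime) (hodd : Odd q) (S : Finset ℤ)
    (hS0 : ∀ s ∈ S, s ≠ 0) (p : ℕ) (hp : p.Prime) (hpS : ∀ s ∈ S, ¬ (p : ℤ) ∣ s) :
    ∃ L : (Fin (qPrimes q S).card → ZMod q) →ₗ[ZMod q] ZMod q,
      (∀ e : Fin (qPrimes q S).card → ℕ, L (fun i => (e i : ZMod q)) = 0 ↔
        ∃ y : ZMod p, y ^ q = ∏ i, (psOf (qPrimes q S) i : ZMod p) ^ e i) ∧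
      ∀ s ∈ S, L (vecOf q (qPrimes q S) s) = 0 ↔ ∃ x : ℤ, (p : ℤ) ∣ x ^ q - s := by
  have := Fact.mk hp
  obtain ⟨χ, hχ⟩ := char_exists p q hp hq
  have hunit : ∀ i, (psOf (qPrimes q S) i : ZMod p) ≠ 0 := by
    intro i h
    rw [ZMod.natCast_eq_zero_iff] at h
    obtain ⟨s, hs, hl, hd, -, -⟩ := (mem_qPrimes q S _).mp (psOf_mem (qPrimes q S) i)
    exact hpS s hs (Int.natCast_dvd.mpr (h.trans hd))
  let w : Fin (qPrimes q S).card → (ZMod p)ˣ := fun i => Units.mk0 _ (hunit i)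
  let L : (Fin (qPrimes q S).card → ZMod q) →ₗ[ZMod q] ZMod q :=
    Fintype.linearCombination (ZMod q) (fun i => (χ (w i)).toAdd)
  have hL : ∀ e : Fin (qPrimes q S).card → ℕ, L (fun i => (e i : ZMod q)) = 0 ↔
        ∃ y : ZMod p, y ^ q = ∏ i, (psOf (qPrimes q S) i : ZMod p) ^ e i := by
    intro e
    have h1 : L (fun i => (e i : ZMod q)) = (χ (∏ i, w i ^ e i)).toAdd := by
      simp only [L, Fintype.linearCombination_apply, map_prod, map_pow, toAdd_prod, toAdd_pow]
      simp
    have h2 : ((∏ i, w i ^ e i : (ZMod p)ˣ) : ZMod p) =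
        ∏ i, (psOf (qPrimes q S) i : ZMod p) ^ e i := by
      push_cast; rfl
    rw [h1, ← h2]
    change χ (∏ i, w i ^ e i) = 1 ↔ _
    rw [hχ]
    constructor
    · rintro ⟨y, hy⟩
      exact ⟨y, by rw [← hy]; push_cast; rfl⟩
    · rintro ⟨y, hy⟩
      have hy0 : y ≠ 0 := by
        rintro rfl
        rw [zero_pow hq.ne_zero] at hy
        exact (Units.ne_zero _) hy.symm
      exact ⟨Units.mk0 y hy0, by ext; rw [← hy]; push_cast; rfl⟩
  refine ⟨L, hL, fun s hs => ?_⟩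
  rw [vecOf_eq, hL, ← zmod_pow_iff]
  obtain ⟨r, hr⟩ := decomp q hodd S hS0 s hs
  have hr' := congrArg (Int.cast : ℤ → ZMod p) hr
  push_cast at hr'
  rw [hr']
  have hr0 : (r : ZMod p) ≠ 0 := by
    intro h
    rw [h, zero_pow hq.ne_zero, zero_mul] at hr'
    exact hpS s hs ((ZMod.intCast_zmod_eq_zero_iff_dvd _ p).mp hr')
  constructor
  · rintro ⟨y, hy⟩
    exact ⟨r * y, by rw [mul_pow, hy]⟩
  · rintro ⟨y, hy⟩
    refine ⟨y / r, ?_⟩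
    rw [div_pow, hy, mul_div_cancel_left₀ _ (pow_ne_zero _ hr0)]

theorem not_dvd_of_coprime (S : Finset ℤ) (p N D : ℕ) (hp : p.Prime) (hpN : p ∣ N)
    (h : Nat.Coprime N (D * ∏ s ∈ S, s.natAbs)) : ∀ s ∈ S, ¬ (p : ℤ) ∣ s := by
  intro s hs hd
  have h1 : p ∣ D * ∏ s ∈ S, s.natAbs :=
    ((Int.natCast_dvd.mp hd).trans (Finset.dvd_prod_of_mem _ hs)).mul_left _
  exact Nat.not_coprime_of_dvd_of_dvd hp.one_lt hpN h1 h

theorem easy_dir (q k : ℕ) (hq : q.Prime) (hodd : Odd q)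
    (S : Finset ℤ) (hS0 : ∀ s ∈ S, s ≠ 0)
    (h : IsKSpace q (qPrimes q S).card k (assocPoints q S)) : MemT q k ↑S := by
  classical
  have := Fact.mk hq
  obtain ⟨W, hW, hB⟩ := h
  refine ⟨q * ∏ s ∈ S, s.natAbs, Nat.mul_pos hq.pos
    (Finset.prod_pos fun s hs => Int.natAbs_pos.mpr (hS0 s hs)), fun N hN hlen hcop => ?_⟩
  have hpS : ∀ p : ℕ, p.Prime → p ∣ N → ∀ s ∈ S, ¬ (p : ℤ) ∣ s := fun p hp hpN =>
    not_dvd_of_coprime S p N q hp hpN hcop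
  have hL : ∀ p : N.primeFactors, ∃ L : (Fin (qPrimes q S).card → ZMod q) →ₗ[ZMod q] ZMod q,
      ∀ s ∈ S, L (vecOf q (qPrimes q S) s) = 0 ↔ ∃ x : ℤ, ((p : ℕ) : ℤ) ∣ x ^ q - s := by
    intro p
    have hp := Nat.prime_of_mem_primeFactors p.2
    obtain ⟨L, -, h2⟩ := local_functional q hq hodd S hS0 p hp
      (hpS p hp (Nat.dvd_of_mem_primeFactors p.2))
    exact ⟨L, h2⟩
  choose L hL using hL
  let g : W →ₗ[ZMod q] (N.primeFactors → ZMod q) := (LinearMap.pi L).comp W.subtype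
  have hker : LinearMap.ker g ≠ ⊥ := by
    apply LinearMap.ker_ne_bot_of_finrank_lt
    rw [hW, Module.finrank_fintype_fun_eq_card, Fintype.card_coe, Nat.lt_succ_iff]
    exact (List.toFinset_card_le _).trans hlen
  obtain ⟨w, hw, hw0⟩ := (Submodule.ne_bot_iff _).mp hker
  have hmem : projPoint (w : Fin (qPrimes q S).card → ZMod q) ∈ assocPoints q S := by
    rw [hB]
    exact ⟨w, w.2, fun h => hw0 (Subtype.ext h), rfl⟩
  obtain ⟨s, hs, hsw⟩ := hmem
  refine ⟨s, hs, ?_⟩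
  have hv : vecOf q (qPrimes q S) s ∈ Submodule.span (ZMod q) {(w : Fin (qPrimes q S).card → ZMod q)} := by
    change _ ∈ projPoint _
    rw [hsw]
    exact Submodule.mem_span_singleton_self _
  obtain ⟨c, hc⟩ := Submodule.mem_span_singleton.mp hv
  apply hensel N q hN hq s
  · rintro p hp hpN rfl
    exact Nat.not_coprime_of_dvd_of_dvd hp.one_lt hpN (dvd_mul_right _ _) hcop
  · exact fun p hp hpN => hpS p hp hpN s hs
  · intro p hp hpN
    have hpm : p ∈ N.primeFactors := Nat.mem_primeFactors.mpr ⟨hp, hpN, hN.ne'⟩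
    rw [← hL ⟨p, hpm⟩ s hs, ← hc, map_smul]
    have : L ⟨p, hpm⟩ w = 0 := congrFun (LinearMap.mem_ker.mp hw) ⟨p, hpm⟩
    rw [this, smul_zero]

theorem block_prime (q : ℕ) (hq : q.Prime) (hodd : Odd q)
    (S : Finset ℤ) (hS0 : ∀ s ∈ S, s ≠ 0) (Δ : ℕ) (hΔ : 0 < Δ)
    (f : (Fin (qPrimes q S).card → ZMod q) →ₗ[ZMod q] ZMod q) :
    ∃ p : ℕ, 0 < p ∧ p.primeFactorsList.length ≤ 1 ∧ Nat.Coprime p Δ ∧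
      ∀ s ∈ S, (∃ x : ℤ, (p : ℤ) ∣ x ^ q - s) → f (vecOf q (qPrimes q S) s) = 0 := by
  classical
  have := Fact.mk hq
  by_cases hf0 : f = 0
  · exact ⟨1, one_pos, by simp, Nat.coprime_one_left _, fun s _ _ => by simp [hf0]⟩
  have hrep : ∀ v, f v = ∑ i, v i * f (Pi.single i 1) := by
    intro v
    conv_lhs => rw [← Finset.univ_sum_single v]
    rw [map_sum]
    refine Finset.sum_congr rfl fun i _ => ?_
    rw [show (Pi.single i (v i) : Fin (qPrimes q S).card → ZMod q) = v i • Pi.single i 1 by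
      rw [← Pi.single_smul, smul_eq_mul, mul_one], map_smul, smul_eq_mul]
  have hM : 0 < Δ * ∏ s ∈ S, s.natAbs := Nat.mul_pos hΔ
    (Finset.prod_pos fun s hs => Int.natAbs_pos.mpr (hS0 s hs))
  obtain ⟨p, hp, hpM, -, h1, h2⟩ := core q (qPrimes q S).card hq (psOf (qPrimes q S))
    (fun i => by
      obtain ⟨s, -, hl, -⟩ := (mem_qPrimes q S _).mp (psOf_mem (qPrimes q S) i)
      exact hl) (psOf_inj _) (fun i => f (Pi.single i 1)) (by
      intro h
      apply hf0
      ext i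
      exact congrFun h i) (Δ * ∏ s ∈ S, s.natAbs) hM
  obtain ⟨L, hL1, hL2⟩ := local_functional q hq hodd S hS0 p hp
    (not_dvd_of_coprime S p p Δ hp dvd_rfl ((Nat.Prime.coprime_iff_not_dvd hp).mpr hpM))
  refine ⟨p, hp.pos, by rw [Nat.primeFactorsList_prime hp]; simp,
    (Nat.Prime.coprime_iff_not_dvd hp).mpr fun h => hpM (h.mul_right _), ?_⟩
  have hval : ∀ v : Fin (qPrimes q S).card → ZMod q, (fun i => (((v i).val : ℕ) : ZMod q)) = v := by
    intro v
    funext i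
    rw [ZMod.natCast_zmod_val]
  have hker : ∀ v, f v = 0 → L v = 0 := by
    intro v hv
    have := (hL1 (fun i => (v i).val)).mpr (h1 _ (by
      rw [hrep] at hv
      rw [← hv]
      refine Finset.sum_congr rfl fun i _ => ?_
      rw [ZMod.natCast_zmod_val]))
    rwa [hval] at this
  intro s hs hx
  have hLs := (hL2 s hs).mpr hx
  by_contra hfs
  apply h2
  have hL0 : ∀ w, L w = 0 := by
    intro w
    have := hker (w - (f w / f (vecOf q (qPrimes q S) s)) • vecOf q (qPrimes q S) s) (by
      rw [map_sub, map_smul, smul_eq_mul, div_mul_cancel₀ _ hfs, sub_self])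
    rwa [map_sub, map_smul, hLs, smul_zero, sub_zero] at this
  intro i
  obtain ⟨y, hy⟩ := (hL1 (Pi.single i 1)).mp (hL0 _)
  refine ⟨y, ?_⟩
  rw [hy, Finset.prod_eq_single i]
  · simp
  · intro j _ hj
    simp [Pi.single_eq_of_ne hj]
  · simp

theorem omega_prod {ι : Type*} (T : Finset ι) (p : ι → ℕ) (hp : ∀ i, 0 < p i)
    (h : ∀ i, (p i).primeFactorsList.length ≤ 1) :
    (∏ i ∈ T, p i).primeFactorsList.length ≤ T.card := by
  classical
  induction T using Finset.induction_on with
  | empty => simp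
  | insert a T ha ih =>
    rw [Finset.prod_insert ha, Finset.card_insert_of_notMem ha,
      ← ArithmeticFunction.cardFactors_apply, ArithmeticFunction.cardFactors_mul (hp a).ne'
        (Finset.prod_pos fun i _ => hp i).ne', ArithmeticFunction.cardFactors_apply,
        ArithmeticFunction.cardFactors_apply]
    have := h a
    omega

theorem hard_dir (q k : ℕ) (hq : q.Prime) (hodd : Odd q)
    (S : Finset ℤ) (hS0 : ∀ s ∈ S, s ≠ 0) (hSpow : ∀ s ∈ S, ¬ IsPerfectPow q s)
    (hcard : S.card = ∑ i ∈ Finset.range (k + 1), q ^ i) (h : MemT q k ↑S) :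
    IsKSpace q (qPrimes q S).card k (assocPoints q S) := by
  classical
  have := Fact.mk hq
  obtain ⟨Δ, hΔ, hT⟩ := h
  refine bose_burton (F := ZMod q) k S (vecOf q (qPrimes q S))
    (fun s hs => vecOf_ne_zero q hodd S hS0 hSpow s hs) (by rw [Nat.card_zmod]; exact hcard) ?_
  intro U hU
  have h1 := Submodule.finrank_quotient_add_finrank U
  let b := Module.finBasis (ZMod q) ((Fin (qPrimes q S).card → ZMod q) ⧸ U)
  let f : Fin (Module.finrank (ZMod q) ((Fin (qPrimes q S).card → ZMod q) ⧸ U)) →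
      (Fin (qPrimes q S).card → ZMod q) →ₗ[ZMod q] ZMod q := fun j => (b.coord j).comp U.mkQ
  choose p hp0 hp1 hpc hpf using fun j => block_prime q hq hodd S hS0 Δ hΔ (f j)
  obtain ⟨s, hs, x, hx⟩ := hT (∏ j, p j) (Finset.prod_pos fun j _ => hp0 j)
    ((omega_prod Finset.univ p hp0 hp1).trans (by
      rw [Finset.card_univ, Fintype.card_fin]; omega))
    (Nat.Coprime.prod_left fun j _ => hpc j)
  refine ⟨s, hs, ?_⟩
  have h2 : U.mkQ (vecOf q (qPrimes q S) s) = 0 := by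
    apply b.ext_elem
    intro j
    rw [map_zero, Finsupp.zero_apply]
    exact hpf j s hs ⟨x, (Int.natCast_dvd_natCast.mpr
      (Finset.dvd_prod_of_mem p (Finset.mem_univ j))).trans hx⟩
  rwa [Submodule.mkQ_apply, Submodule.Quotient.mk_eq_zero] at h2

/-- **Proposition (classification, first part).** If `|S| = q^k + ⋯ + q + 1` and `S` contains no
perfect `q`-th power, then `S ∈ 𝒯_{k,q}` iff the set of projective points associated with `S`
is a `k`-space of `PG(F_q^n)`. -/
theorem stmt10 (q k : ℕ) (hq : q.Prime) (hodd : Odd q) (hk : 1 ≤ k)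
    (S : Finset ℤ) (hS0 : ∀ s ∈ S, s ≠ 0) (hSpow : ∀ s ∈ S, ¬ IsPerfectPow q s)
    (hcard : S.card = ∑ i ∈ Finset.range (k + 1), q ^ i) :
    MemT q k ↑S ↔ IsKSpace q (qPrimes q S).card k (assocPoints q S) := by
  exact ⟨hard_dir q k hq hodd S hS0 hSpow hcard, easy_dir q k hq hodd S hS0⟩
end

section
/- Let q be an odd prime, k ≥ 1 a natural number, and p̄_1, …, p̄_{k+1} distinct primes. Then the set S̄ = ⋃_{i=1}^{k+1} { p̄_i · ∏_{j=i+1}^{k+1} p̄_j^{α_j} : α_{i+1}, …, α_{k+1} ∈ {0, 1, …, q−1} } has exactly (q^{k+1} − 1)/(q − 1) elements, contains no perfect q-th power, and belongs to 𝒯_{k,q}. -/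
open Finset

/-- The standard minimum-size set
`S̄ = ⋃_{i=1}^{k+1} { p̄_i ∏_{j>i} p̄_j^{α_j} : α_j ∈ {0, …, q-1} }`. -/
def standardSet (q k : ℕ) (pbar : Fin (k + 1) → ℕ) : Finset ℤ :=
  Finset.image
    (fun x : Fin (k + 1) × (Fin (k + 1) → Fin q) =>
      (pbar x.1 : ℤ) *
        ∏ j ∈ Finset.univ.filter (fun j => x.1 < j), (pbar j : ℤ) ^ (x.2 j : ℕ))
    Finset.univ

lemma aux_torsion (q : ℕ) (hq : q.Prime) (hodd : Odd q) (N : ℕ) (hN : Nat.Coprime N q) :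
    Nat.card {u : (ZMod N)ˣ // u ^ q = 1} ≤ q ^ N.primeFactorsList.length := by
  classical
  induction N using Nat.recOnPosPrimePosCoprime with
  | prime_pow p n hp hn =>
    have : NeZero (p ^ n) := ⟨pow_ne_zero _ hp.ne_zero⟩
    have h1 : Nat.card {u : (ZMod (p ^ n))ˣ // u ^ q = 1} ≤ q := by
      by_cases h2 : p = 2
      · subst h2
        have : Subsingleton {u : (ZMod (2 ^ n))ˣ // u ^ q = 1} := by
          have key : ∀ u : (ZMod (2 ^ n))ˣ, u ^ q = 1 → u = 1 := by
            intro u hu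
            have h3 : orderOf u ∣ q := orderOf_dvd_of_pow_eq_one hu
            have h4 : orderOf u ∣ 2 ^ (n - 1) := by
              have := orderOf_dvd_card (x := u)
              rw [ZMod.card_units_eq_totient, Nat.totient_prime_pow hp hn] at this
              simpa using this
            have h5 : Nat.Coprime q (2 ^ (n - 1)) :=
              Nat.Coprime.pow_right _ hodd.coprime_two_right
            have := Nat.eq_one_of_dvd_coprimes h5 h3 h4
            exact orderOf_eq_one_iff.mp this
          exact ⟨fun a b => Subtype.ext ((key _ a.2).trans (key _ b.2).symm)⟩
        exact (Finite.card_le_one_iff_subsingleton.mpr this).trans hq.one_le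
      · have := ZMod.isCyclic_units_of_prime_pow p hp h2 n
        have := IsCyclic.card_pow_eq_one_le (α := (ZMod (p ^ n))ˣ) hq.pos
        rw [Nat.card_eq_fintype_card, Fintype.card_subtype]
        exact this
    refine h1.trans ?_
    rw [hp.primeFactorsList_pow, List.length_replicate]
    exact Nat.le_self_pow hn.ne' q
  | zero =>
    simp at hN
    exact absurd hN hq.one_lt.ne'
  | one =>
    have : Subsingleton {u : (ZMod 1)ˣ // u ^ q = 1} := inferInstance
    simpa using (Finite.card_le_one_iff_subsingleton.mpr this)
  | coprime a b ha hb hab iha ihb =>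
    have ha' := iha (Nat.Coprime.coprime_mul_right hN)
    have hb' := ihb (Nat.Coprime.coprime_mul_left hN)
    have : NeZero a := ⟨by omega⟩
    have : NeZero b := ⟨by omega⟩
    have hl : (a * b).primeFactorsList.length
        = a.primeFactorsList.length + b.primeFactorsList.length :=
      ArithmeticFunction.cardFactors_mul (by omega) (by omega)
    rw [hl, pow_add]
    let e : (ZMod (a * b))ˣ ≃* (ZMod a)ˣ × (ZMod b)ˣ :=
      (Units.mapEquiv (ZMod.chineseRemainder hab).toMulEquiv).trans MulEquiv.prodUnits
    refine le_trans ?_ (Nat.mul_le_mul ha' hb')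
    rw [← Nat.card_prod]
    refine Nat.card_le_card_of_injective
      (fun u => (⟨(e u.1).1, ?_⟩, ⟨(e u.1).2, ?_⟩)) ?_
    · rw [← Prod.pow_fst, ← map_pow, u.2, map_one]; rfl
    · rw [← Prod.pow_snd, ← map_pow, u.2, map_one]; rfl
    · intro u v h
      simp only [Prod.mk.injEq, Subtype.mk.injEq] at h
      exact Subtype.ext (e.injective (Prod.ext h.1 h.2))

lemma aux_index (q : ℕ) (hq : q.Prime) (hodd : Odd q) (N : ℕ) (hN0 : 0 < N)
    (hN : Nat.Coprime N q) :
    Nat.card ((ZMod N)ˣ ⧸ (powMonoidHom q : (ZMod N)ˣ →* (ZMod N)ˣ).range)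
      ≤ q ^ N.primeFactorsList.length := by
  have : NeZero N := ⟨hN0.ne'⟩
  have h := Subgroup.index_range (f := (powMonoidHom q : (ZMod N)ˣ →* (ZMod N)ˣ))
  rw [Subgroup.index_eq_card] at h
  rw [h]
  refine le_trans (le_of_eq ?_) (aux_torsion q hq hodd N hN)
  exact Nat.card_congr (Equiv.subtypeEquivRight fun u => by simp [MonoidHom.mem_ker])

/-- Exponent vectors whose first nonzero entry is a `1` in position `i`. -/
def auxE (q k : ℕ) (i : Fin (k + 1)) : Finset (Fin (k + 1) → ℕ) :=
  Fintype.piFinset fun j => if j < i then {0} else if j = i then {1} else Finset.range q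

/-- Value of an exponent vector. -/
def auxF (k : ℕ) (p : Fin (k + 1) → ℕ) (e : Fin (k + 1) → ℕ) : ℕ := ∏ j, p j ^ e j

lemma aux_fact (k : ℕ) (p : Fin (k + 1) → ℕ) (hp : ∀ i, (p i).Prime)
    (hinj : Function.Injective p) (e : Fin (k + 1) → ℕ) (i : Fin (k + 1)) :
    (auxF k p e).factorization (p i) = e i := by
  unfold auxF
  rw [Nat.factorization_prod_apply (fun x _ => pow_ne_zero _ (hp x).ne_zero)]
  rw [Finset.sum_eq_single i]
  · simp [(hp i).factorization_self]
  · intro j _ hj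
    rw [Nat.factorization_pow, (hp j).factorization]
    simp [hinj.ne hj]
  · simp

lemma aux_val (k : ℕ) (p : Fin (k + 1) → ℕ) (i : Fin (k + 1)) (e : Fin (k + 1) → ℕ)
    (h0 : ∀ j < i, e j = 0) (h1 : e i = 1) :
    (auxF k p e : ℤ) =
      (p i : ℤ) * ∏ j ∈ Finset.univ.filter (fun j => i < j), (p j : ℤ) ^ (e j) := by
  unfold auxF
  push_cast
  rw [← Finset.mul_prod_erase _ _ (Finset.mem_univ i), h1, pow_one]
  congr 1
  symm
  apply Finset.prod_subset
  · intro j hj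
    simp at hj ⊢
    exact hj.ne'
  · intro j hj hj'
    simp at hj hj'
    rw [h0 j (lt_of_le_of_ne hj' hj), pow_zero]

lemma auxE_mem (q k : ℕ) (i : Fin (k + 1)) (e : Fin (k + 1) → ℕ) :
    e ∈ auxE q k i ↔ (∀ j < i, e j = 0) ∧ e i = 1 ∧ ∀ j, i < j → e j < q := by
  unfold auxE
  rw [Fintype.mem_piFinset]
  constructor
  · intro h
    refine ⟨fun j hj => ?_, ?_, fun j hj => ?_⟩
    · simpa [hj] using h j
    · simpa using h i
    · simpa [hj.not_gt, hj.ne'] using h j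
  · rintro ⟨h0, h1, h2⟩ j
    rcases lt_trichotomy j i with h | h | h
    · simp [h, h0 j h]
    · subst h; simp [h1]
    · simpa [h.not_gt, h.ne'] using h2 j h

lemma aux_std (q k : ℕ) (hq : q.Prime) (p : Fin (k + 1) → ℕ) :
    standardSet q k p =
      (Finset.univ.biUnion (auxE q k)).image (fun e => (auxF k p e : ℤ)) := by
  have : NeZero q := ⟨hq.ne_zero⟩
  ext s
  simp only [standardSet, Finset.mem_image, Finset.mem_univ, true_and, Finset.mem_biUnion]
  constructor
  · rintro ⟨⟨i, α⟩, rfl⟩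
    let e : Fin (k + 1) → ℕ := fun j => if j < i then 0 else if j = i then 1 else α j
    have h0 : ∀ j < i, e j = 0 := fun j hj => by simp [e, hj]
    have h1 : e i = 1 := by simp [e]
    have h2 : ∀ j, i < j → e j = α j := fun j hj => by simp [e, hj.not_gt, hj.ne']
    refine ⟨e, ⟨i, (auxE_mem _ _ _ _).2 ⟨h0, h1, fun j hj => ?_⟩⟩, ?_⟩
    · rw [h2 j hj]; exact (α j).2
    · rw [aux_val k p i e h0 h1]
      congr 1
      apply Finset.prod_congr rfl
      intro j hj
      rw [h2 j (by simpa using hj)]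
  · rintro ⟨e, ⟨i, he⟩, rfl⟩
    obtain ⟨h0, h1, h2⟩ := (auxE_mem _ _ _ _).1 he
    refine ⟨(i, fun j => Fin.ofNat q (e j)), ?_⟩
    rw [aux_val k p i e h0 h1]
    congr 1
    apply Finset.prod_congr rfl
    intro j hj
    simp [Nat.mod_eq_of_lt (h2 j (by simpa using hj))]

lemma aux_cardE (q k : ℕ) (i : Fin (k + 1)) : (auxE q k i).card = q ^ (k - (i : ℕ)) := by
  unfold auxE
  rw [Fintype.card_piFinset]
  have : ∀ j : Fin (k + 1),
      (if j < i then {0} else if j = i then {1} else Finset.range q : Finset ℕ).card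
        = if i < j then q else 1 := by
    intro j
    rcases lt_trichotomy j i with h | h | h
    · simp [h, h.not_gt]
    · simp [h]
    · simp [h, h.not_gt, h.ne']
  rw [Finset.prod_congr rfl (fun j _ => this j), Finset.prod_ite]
  simp only [Finset.prod_const, one_pow, mul_one]
  congr 1
  have : (Finset.univ.filter (fun j => i < j)) = Finset.Ioi i := by ext; simp
  rw [this, Fin.card_Ioi]
  omega

lemma aux_grp (q k : ℕ) (hq : q.Prime) {Q : Type*} [CommGroup Q] [Fintype Q]
    (hcard : Fintype.card Q ≤ q ^ k) (v : Fin (k + 1) → Q) (hv : ∀ i, v i ^ q = 1) :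
    ∃ i, ∃ e ∈ auxE q k i, ∏ j, v j ^ e j = 1 := by
  classical
  obtain ⟨α, β, hne, hαβ⟩ := Fintype.exists_ne_map_eq_of_card_lt
    (fun α : Fin (k + 1) → Fin q => ∏ j, v j ^ (α j : ℕ)) (by
      refine lt_of_le_of_lt hcard ?_
      simp only [Fintype.card_pi, Fintype.card_fin, Finset.prod_const, Finset.card_univ]
      exact Nat.pow_lt_pow_right hq.one_lt (by omega))
  have hex : ∃ i, α i ≠ β i := by
    by_contra h
    push Not at h
    exact hne (funext h)
  obtain ⟨i, hi, hmin⟩ : ∃ i, α i ≠ β i ∧ ∀ j < i, α j = β j := by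
    refine ⟨(Finset.univ.filter fun i => α i ≠ β i).min' ?_, ?_, ?_⟩
    · obtain ⟨i, hi⟩ := hex
      exact ⟨i, by simpa using hi⟩
    · have := Finset.min'_mem (Finset.univ.filter fun i => α i ≠ β i)
        (by obtain ⟨i, hi⟩ := hex; exact ⟨i, by simpa using hi⟩)
      exact (Finset.mem_filter.1 this).2
    · intro j hj
      by_contra h
      exact absurd (Finset.min'_le (Finset.univ.filter fun i => α i ≠ β i) j (by simpa using h))
        (not_le.2 hj)
  let d : Fin (k + 1) → ℤ := fun j => (α j : ℕ) - (β j : ℕ)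
  have hd : ∏ j, v j ^ d j = 1 := by
    simp only [d, zpow_sub, zpow_natCast, Finset.prod_mul_distrib, Finset.prod_inv_distrib]
    rw [mul_inv_eq_one]
    exact hαβ
  have hcop : IsCoprime (d i) (q : ℤ) := by
    rw [Int.isCoprime_iff_gcd_eq_one, Int.gcd_comm, ← Int.isCoprime_iff_gcd_eq_one]
    refine (Nat.prime_iff_prime_int.1 hq).irreducible.coprime_iff_not_dvd.2 ?_
    intro hdv
    have ha := (α i).2
    have hb := (β i).2
    have : d i = 0 := by
      apply Int.eq_zero_of_abs_lt_dvd hdv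
      simp only [d]
      rw [abs_lt]; omega
    simp only [d] at this
    exact hi (Fin.ext (by omega))
  obtain ⟨c, c', hc⟩ := hcop
  let e : Fin (k + 1) → ℕ := fun j => ((d j * c) % q).toNat
  have hqz : (0 : ℤ) < q := by exact_mod_cast hq.pos
  have he : ∀ j, (e j : ℤ) = (d j * c) % q :=
    fun j => Int.toNat_of_nonneg (Int.emod_nonneg _ hqz.ne')
  have hve : ∏ j, v j ^ e j = 1 := by
    have : ∀ j, v j ^ e j = (v j ^ d j) ^ c := by
      intro j
      rw [← zpow_natCast, he, ← zpow_mul]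
      exact (zpow_eq_zpow_emod' _ (hv j)).symm
    rw [Finset.prod_congr rfl (fun j _ => this j), Finset.prod_zpow, hd, one_zpow]
  refine ⟨i, e, (auxE_mem _ _ _ _).2 ⟨fun j hj => ?_, ?_, fun j _ => ?_⟩, hve⟩
  · simp [e, d, hmin j hj]
  · zify
    rw [he]
    have : d i * c = 1 + q * (-c') := by linarith
    rw [this, Int.add_mul_emod_self_left]
    exact Int.emod_eq_of_lt (by norm_num) (by exact_mod_cast hq.one_lt)
  · zify
    rw [he]
    exact Int.emod_lt_of_pos _ hqz

lemma aux_main (q k : ℕ) (hq : q.Prime) (hodd : Odd q) (p : Fin (k + 1) → ℕ)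
    (N : ℕ) (hN0 : 0 < N) (hNk : N.primeFactorsList.length ≤ k) (hNq : Nat.Coprime N q)
    (hNp : ∀ i, Nat.Coprime N (p i)) :
    ∃ i, ∃ e ∈ auxE q k i, ∃ x : ℤ, (N : ℤ) ∣ x ^ q - (auxF k p e : ℤ) := by
  classical
  have : NeZero N := ⟨hN0.ne'⟩
  have : NeZero q := ⟨hq.ne_zero⟩
  let R := (powMonoidHom q : (ZMod N)ˣ →* (ZMod N)ˣ).range
  let u : Fin (k + 1) → (ZMod N)ˣ := fun i => ZMod.unitOfCoprime (p i) (hNp i).symm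
  let v : Fin (k + 1) → (ZMod N)ˣ ⧸ R := fun i => QuotientGroup.mk' R (u i)
  have hv : ∀ i, v i ^ q = 1 := by
    intro i
    change QuotientGroup.mk' R (u i) ^ q = 1
    rw [← map_pow]
    exact (QuotientGroup.eq_one_iff _).2 ⟨u i, rfl⟩
  have : Fintype ((ZMod N)ˣ ⧸ R) := Fintype.ofFinite _
  obtain ⟨i, e, he, hve⟩ := aux_grp q k hq (Q := (ZMod N)ˣ ⧸ R) (by
      rw [← Nat.card_eq_fintype_card]
      exact (aux_index q hq hodd N hN0 hNq).trans (Nat.pow_le_pow_right hq.pos hNk)) v hv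
  refine ⟨i, e, he, ?_⟩
  · have h1 : QuotientGroup.mk' R (∏ j, u j ^ e j) = 1 := by
      rw [map_prod, ← hve]
      exact Finset.prod_congr rfl (fun j _ => map_pow _ _ _)
    obtain ⟨y, hy⟩ := (QuotientGroup.eq_one_iff _).1 h1
    have hy' : ((y : ZMod N)) ^ q = ∏ j, (p j : ZMod N) ^ e j := by
      have := congrArg (Units.val) hy
      simpa [u, Units.coe_prod] using this
    refine ⟨((y : ZMod N).val : ℤ), ?_⟩
    rw [← ZMod.intCast_zmod_eq_zero_iff_dvd]
    unfold auxF
    push_cast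
    rw [ZMod.natCast_zmod_val, hy', sub_self]

/-- **Proposition.** The standard set `S̄` built on `k+1` distinct primes has exactly
`(q^{k+1} - 1)/(q - 1)` elements, contains no perfect `q`-th power, and belongs to
`𝒯_{k,q}`. -/
theorem stmt12 (q k : ℕ) (hq : q.Prime) (hodd : Odd q) (hk : 1 ≤ k)
    (pbar : Fin (k + 1) → ℕ) (hpbar : ∀ i, (pbar i).Prime)
    (hpbarinj : Function.Injective pbar) :
    (standardSet q k pbar).card = (∑ i ∈ Finset.range (k + 1), q ^ i) ∧
      (∀ m ∈ standardSet q k pbar, ¬ IsPerfectPow q m) ∧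
      MemT q k ↑(standardSet q k pbar) := by
  rw [aux_std q k hq pbar]
  refine ⟨?_, ?_, ?_⟩
  · rw [Finset.card_image_of_injective, Finset.card_biUnion]
    · rw [Finset.sum_congr rfl (fun i _ => aux_cardE q k i),
        Fin.sum_univ_eq_sum_range (fun i => q ^ (k - i)) (k + 1)]
      exact Finset.sum_range_reflect (fun i => q ^ i) (k + 1)
    · have key : ∀ i j : Fin (k + 1), i < j → Disjoint (auxE q k i) (auxE q k j) := by
        intro i j hij
        rw [Finset.disjoint_left]
        intro e he he'
        have h1 := ((auxE_mem _ _ _ _).1 he).2.1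
        have h2 := ((auxE_mem _ _ _ _).1 he').1 i hij
        omega
      intro i _ j _ hij
      rcases lt_or_gt_of_ne hij with h | h
      · exact key i j h
      · exact (key j i h).symm
    · intro e e' h
      have h' : auxF k pbar e = auxF k pbar e' := Nat.cast_injective (R := ℤ) h
      funext i
      rw [← aux_fact k pbar hpbar hpbarinj e i, h', aux_fact k pbar hpbar hpbarinj]
  · intro m hm
    simp only [Finset.mem_image, Finset.mem_univ, true_and, Finset.mem_biUnion] at hm
    obtain ⟨e, ⟨i, he⟩, rfl⟩ := hm
    rintro ⟨r, hr⟩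
    have h1 := ((auxE_mem _ _ _ _).1 he).2.1
    have h2 := congrArg Int.natAbs hr
    rw [Int.natAbs_pow, Int.natAbs_natCast] at h2
    have h3 := aux_fact k pbar hpbar hpbarinj e i
    rw [← h2, h1, Nat.factorization_pow] at h3
    simp at h3
    exact hq.one_lt.ne' h3.1
  · refine ⟨q * ∏ i, pbar i,
      Nat.mul_pos hq.pos (Finset.prod_pos fun i _ => (hpbar i).pos), ?_⟩
    intro N hN0 hNk hN
    obtain ⟨i, e, he, x, hx⟩ := aux_main q k hq hodd pbar N hN0 hNk
      (Nat.Coprime.coprime_mul_right_right hN)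
      (fun i => Nat.Coprime.coprime_dvd_right
        (Finset.dvd_prod_of_mem _ (Finset.mem_univ i)) (Nat.Coprime.coprime_mul_left_right hN))
    refine ⟨_, ?_, x, hx⟩
    simp only [Finset.coe_image, Set.mem_image, Finset.mem_coe, Finset.mem_biUnion,
      Finset.mem_univ, true_and]
    exact ⟨e, ⟨i, he⟩, rfl⟩
end
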